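/- arXiv:2005.05200 — 2 statements merged into one kernel-verified Lean document; each statement's English description precedes it below -/
import Mathlib

section
/- Let u be the unique classical solution of the limit problem (2.7). Then u is a weak solution: u is bounded, the spatial derivative u_x (defined on Q ∖ N) belongs to L²(Q), u(a,t) = −1 and u(b,t) = 1 for a.e. t ∈ (0,T), and for every continuously differentiable test function ψ with compact support in (a,b) × [0,T) one has ∫_a^b u₀(x) ψ(x,0) dx + ∬_Q ( u ψ_t − |u| u_x ψ_x − u_x² sgn(u) ψ + u(1 − |u|) ψ ) dx dt = 0. -/
open Set Filter MeasureTheory Topology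

/-- Partial derivative in `x` of `u(x,t)`. -/
noncomputable def pdx (u : ℝ → ℝ → ℝ) (x t : ℝ) : ℝ := deriv (fun y => u y t) x

/-- Second partial derivative in `x` of `u(x,t)`. -/
noncomputable def pdxx (u : ℝ → ℝ → ℝ) (x t : ℝ) : ℝ := deriv (fun y => pdx u y t) x

/-- Partial derivative in `t` of `u(x,t)`, one-sided at `t = T`. -/
noncomputable def pdtW (T : ℝ) (u : ℝ → ℝ → ℝ) (x t : ℝ) : ℝ :=
  derivWithin (fun s => u x s) (Set.Iic T) t

/-- `Q = (a,b) × (0,T]`. -/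
def QT (a b T : ℝ) : Set (ℝ × ℝ) := Set.Ioo a b ×ˢ Set.Ioc 0 T

/-- `N = N₀ × [0,T]`. -/
def NSet (N₀ : Set ℝ) (T : ℝ) : Set (ℝ × ℝ) := N₀ ×ˢ Set.Icc 0 T

/-- Condition (2.8): `u₀` is continuous, `u₀(a) = -1`, `u₀(b) = 1`, the zeros of `u₀`
form the finite set `N₀ ⊆ (a,b)`, and `u₀` changes sign at each of its zeros. -/
structure InitData (a b : ℝ) (N₀ : Set ℝ) (u₀ : ℝ → ℝ) : Prop where
  cont : ContinuousOn u₀ (Set.Icc a b)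
  bdry_a : u₀ a = -1
  bdry_b : u₀ b = 1
  fin : N₀.Finite
  sub : N₀ ⊆ Set.Ioo a b
  zeros : ∀ x ∈ Set.Icc a b, (u₀ x = 0 ↔ x ∈ N₀)
  sign_change : ∀ x ∈ N₀, ∀ δ > 0,
    ∃ y ∈ Set.Ioo (x - δ) x, ∃ z ∈ Set.Ioo x (x + δ), u₀ y * u₀ z < 0

/-- A classical solution of the limit problem (2.7): `u ∈ C(Q̄)` vanishing exactly on `N`,
`C^{2,1}` on `Q ∖ N`, with boundary values `∓1`, initial value `u₀`, satisfying
`u_t = |u| u_xx + u(1-|u|)` on `Q ∖ N`. -/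
structure IsClassicalSol (a b T : ℝ) (N₀ : Set ℝ) (u₀ : ℝ → ℝ) (u : ℝ → ℝ → ℝ) : Prop where
  cont : ContinuousOn (fun p : ℝ × ℝ => u p.1 p.2) (Set.Icc a b ×ˢ Set.Icc 0 T)
  zero_iff : ∀ x ∈ Set.Icc a b, ∀ t ∈ Set.Icc 0 T, (u x t = 0 ↔ x ∈ N₀)
  diff_x : ∀ p ∈ QT a b T \ NSet N₀ T, DifferentiableAt ℝ (fun y => u y p.2) p.1
  diff_xx : ∀ p ∈ QT a b T \ NSet N₀ T, DifferentiableAt ℝ (fun y => pdx u y p.2) p.1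
  diff_t : ∀ p ∈ QT a b T \ NSet N₀ T,
    DifferentiableWithinAt ℝ (fun s => u p.1 s) (Set.Iic T) p.2
  cont_x : ContinuousOn (fun p : ℝ × ℝ => pdx u p.1 p.2) (QT a b T \ NSet N₀ T)
  cont_xx : ContinuousOn (fun p : ℝ × ℝ => pdxx u p.1 p.2) (QT a b T \ NSet N₀ T)
  cont_t : ContinuousOn (fun p : ℝ × ℝ => pdtW T u p.1 p.2) (QT a b T \ NSet N₀ T)
  bdry_a : ∀ t ∈ Set.Ioc 0 T, u a t = -1
  bdry_b : ∀ t ∈ Set.Ioc 0 T, u b t = 1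
  init : ∀ x ∈ Set.Ioo a b, u x 0 = u₀ x
  pde : ∀ p ∈ QT a b T \ NSet N₀ T,
    pdtW T u p.1 p.2 = |u p.1 p.2| * pdxx u p.1 p.2 + u p.1 p.2 * (1 - |u p.1 p.2|)


theorem countable_setOf_eq_and_deriv_ne_zero (f : ℝ → ℝ) (c : ℝ) :
    {x | f x = c ∧ deriv f x ≠ 0}.Countable := by
  have hd : DiscreteTopology {x | f x = c ∧ deriv f x ≠ 0} := by
    rw [discreteTopology_subtype_iff]
    rintro x ⟨-, hx⟩
    have hne := (differentiableAt_of_deriv_ne_zero hx).hasDerivAt.eventually_ne (c := c) hx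
    rw [← disjoint_iff, Filter.disjoint_principal_right]
    filter_upwards [hne] with z hz h
    exact hz h.1
  exact (HereditarilyLindelofSpace.isLindelof _).countable hd

theorem Real.sign_eq_div_abs {s : ℝ} (hs : s ≠ 0) : Real.sign s = s / |s| := by
  rcases lt_or_gt_of_ne hs with h | h
  · rw [Real.sign_of_neg h, abs_of_neg h, div_neg, div_self hs]
  · rw [Real.sign_of_pos h, abs_of_pos h, div_self hs]

theorem Real.continuousOn_sign : ContinuousOn Real.sign {0}ᶜ := by
  have h : ContinuousOn (fun s : ℝ => s / |s|) {0}ᶜ :=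
    continuousOn_id.div continuous_abs.continuousOn fun s hs => abs_ne_zero.2 hs
  exact h.congr fun s hs => Real.sign_eq_div_abs hs

theorem Real.abs_sign_le_one (s : ℝ) : |Real.sign s| ≤ 1 := by
  rcases Real.sign_apply_eq s with h | h | h <;> rw [h] <;> norm_num

theorem Real.hasDerivAt_abs_sign {s : ℝ} (hs : s ≠ 0) :
    HasDerivAt (fun r : ℝ => |r|) (Real.sign s) s := by
  rcases lt_or_gt_of_ne hs with h | h
  · rw [Real.sign_of_neg h]
    exact hasDerivAt_abs_neg h
  · rw [Real.sign_of_pos h]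
    exact hasDerivAt_abs_pos h

theorem HasDerivAt.sign_mul {f : ℝ → ℝ} {f' s : ℝ} (hf : HasDerivAt f f' s) (hs : s ≠ 0) :
    HasDerivAt (fun r => Real.sign r * f r) (Real.sign s * f') s := by
  rcases lt_or_gt_of_ne hs with h | h
  · refine (hf.const_mul (Real.sign s)).congr_of_eventuallyEq ?_
    filter_upwards [Iio_mem_nhds h] with r hr
    rw [Real.sign_of_neg h, Real.sign_of_neg hr]
  · refine (hf.const_mul (Real.sign s)).congr_of_eventuallyEq ?_
    filter_upwards [Ioi_mem_nhds h] with r hr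
    rw [Real.sign_of_pos h, Real.sign_of_pos hr]

section Geometry

variable {a b T : ℝ} {N₀ : Set ℝ}

theorem mem_QT_diff_NSet {x t : ℝ} (hx : x ∈ Ioo a b) (hN : x ∉ N₀) (ht : t ∈ Ioc 0 T) :
    (x, t) ∈ QT a b T \ NSet N₀ T :=
  ⟨⟨hx, ht⟩, fun h => hN h.1⟩

theorem QT_diff_NSet_eq : QT a b T \ NSet N₀ T = (Ioo a b \ N₀) ×ˢ Ioc 0 T := by
  ext ⟨x, t⟩
  simp only [QT, NSet, Set.mem_sdiff, mem_prod]
  exact ⟨fun h => ⟨⟨h.1.1, fun hx => h.2 ⟨hx, Ioc_subset_Icc_self h.1.2⟩⟩, h.1.2⟩,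
    fun h => ⟨⟨h.1.1, h.2⟩, fun hx => h.1.2 hx.1⟩⟩

theorem measurableSet_QT_diff_NSet (hN : N₀.Finite) : MeasurableSet (QT a b T \ NSet N₀ T) := by
  rw [QT_diff_NSet_eq]
  exact (measurableSet_Ioo.diff hN.measurableSet).prod measurableSet_Ioc

/-- The exceptional segments are negligible in `Q`. -/
theorem ae_restrict_QT_notMem (hN : N₀.Finite) :
    ∀ᵐ p ∂(volume.restrict (QT a b T)), p ∈ QT a b T \ NSet N₀ T := by
  have h0 : volume (NSet N₀ T) = 0 := by
    rw [NSet, Measure.volume_eq_prod, Measure.prod_prod, hN.measure_zero, zero_mul]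
  have h1 : ∀ᵐ p ∂(volume.restrict (QT a b T)), p ∉ NSet N₀ T :=
    ae_restrict_of_ae (measure_eq_zero_iff_ae_notMem.1 h0)
  filter_upwards [h1, ae_restrict_mem (measurableSet_Ioo.prod measurableSet_Ioc)] with p h hp
  exact ⟨hp, h⟩

/-- A function continuous off the exceptional segments and vanishing near them and near the
lateral boundary is continuous up to the lateral boundary. -/
theorem continuousOn_of_vanish_near {f : ℝ × ℝ → ℝ} (hN : N₀.Finite)
    (hf : ContinuousOn f (QT a b T \ NSet N₀ T))
    (hv : ∀ y ∈ insert a (insert b N₀), ∀ᶠ x in 𝓝 y, x ∈ Icc a b → ∀ t ∈ Ioc 0 T, f (x, t) = 0) :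
    ContinuousOn f (Icc a b ×ˢ Ioc 0 T) := by
  rintro ⟨x, t⟩ ⟨hx, ht⟩
  by_cases hy : x ∈ insert a (insert b N₀)
  · have h0 : ∀ᶠ p in 𝓝[Icc a b ×ˢ Ioc 0 T] (x, t), f p = 0 := by
      have h1 : ∀ᶠ p : ℝ × ℝ in 𝓝 (x, t), p.1 ∈ Icc a b → ∀ t ∈ Ioc 0 T, f (p.1, t) = 0 :=
        (continuous_fst.tendsto (x, t)).eventually (hv x hy)
      filter_upwards [nhdsWithin_le_nhds h1, self_mem_nhdsWithin] with p hp hp'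
      exact hp hp'.1 p.2 hp'.2
    have hxt : f (x, t) = 0 := (hv x hy).self_of_nhds hx t ht
    exact (continuousWithinAt_const (b := (0 : ℝ))).congr_of_eventuallyEq h0 hxt
  · simp only [mem_insert_iff, not_or] at hy
    have hx' : x ∈ Ioo a b := ⟨lt_of_le_of_ne hx.1 (Ne.symm hy.1), lt_of_le_of_ne hx.2 hy.2.1⟩
    refine (hf (x, t) (mem_QT_diff_NSet hx' hy.2.2 ht)).mono_of_mem_nhdsWithin ?_
    have ho : IsOpen (Ioo a b \ N₀) := isOpen_Ioo.sdiff hN.isClosed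
    have h1 : ∀ᶠ p : ℝ × ℝ in 𝓝 (x, t), p.1 ∈ Ioo a b \ N₀ :=
      (continuous_fst.tendsto (x, t)).eventually (ho.mem_nhds ⟨hx', hy.2.2⟩)
    filter_upwards [nhdsWithin_le_nhds h1, self_mem_nhdsWithin] with p hp hp'
    exact mem_QT_diff_NSet hp.1 hp.2 hp'.2

end Geometry

section Solution

variable {a b T : ℝ} {N₀ : Set ℝ} {u₀ : ℝ → ℝ} {u : ℝ → ℝ → ℝ}

theorem IsClassicalSol.continuousOn_off (hu : IsClassicalSol a b T N₀ u₀ u) :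
    ContinuousOn (fun p : ℝ × ℝ => u p.1 p.2) (QT a b T \ NSet N₀ T) :=
  hu.cont.mono fun _ hp => ⟨Ioo_subset_Icc_self hp.1.1, Ioc_subset_Icc_self hp.1.2⟩

theorem IsClassicalSol.ne_zero (hu : IsClassicalSol a b T N₀ u₀ u) {p : ℝ × ℝ}
    (hp : p ∈ QT a b T \ NSet N₀ T) : u p.1 p.2 ≠ 0 := fun h =>
  hp.2 ⟨(hu.zero_iff p.1 (Ioo_subset_Icc_self hp.1.1) p.2 (Ioc_subset_Icc_self hp.1.2)).1 h,
    Ioc_subset_Icc_self hp.1.2⟩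

theorem IsClassicalSol.exists_bound (hu : IsClassicalSol a b T N₀ u₀ u) :
    ∃ M : ℝ, ∀ x ∈ Icc a b, ∀ t ∈ Icc (0 : ℝ) T, |u x t| ≤ M := by
  obtain ⟨M, hM⟩ := (isCompact_Icc.prod isCompact_Icc).exists_bound_of_continuousOn hu.cont
  exact ⟨M, fun x hx t ht => hM (x, t) ⟨hx, ht⟩⟩

theorem IsClassicalSol.eventually_abs_sub_lt (hu : IsClassicalSol a b T N₀ u₀ u) {y δ : ℝ}
    (hy : y ∈ Icc a b) (hδ : 0 < δ) :
    ∃ r > 0, ∀ x ∈ Icc a b, |x - y| < r → ∀ t ∈ Icc 0 T, |u x t - u y t| < δ := by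
  have huc := (isCompact_Icc.prod isCompact_Icc).uniformContinuousOn_of_continuous hu.cont
  obtain ⟨r, hr, h⟩ := Metric.uniformContinuousOn_iff.1 huc δ hδ
  refine ⟨r, hr, fun x hx hxy t ht => ?_⟩
  have := h (x, t) ⟨hx, ht⟩ (y, t) ⟨hy, ht⟩ (by simpa [Prod.dist_eq, Real.dist_eq] using hxy)
  simpa [Real.dist_eq] using this

/-- On a level set of `u` the spatial derivative vanishes almost everywhere. -/
theorem IsClassicalSol.ae_ne_or_pdx_eq_zero (hN : N₀.Finite)
    (hu : IsClassicalSol a b T N₀ u₀ u) (c : ℝ) :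
    ∀ᵐ p ∂(volume.restrict (QT a b T)), u p.1 p.2 ≠ c ∨ pdx u p.1 p.2 = 0 := by
  set S : Set (ℝ × ℝ) :=
    {p | p ∈ QT a b T \ NSet N₀ T ∧ u p.1 p.2 = c ∧ pdx u p.1 p.2 ≠ 0} with hS
  have hG := measurableSet_QT_diff_NSet (a := a) (b := b) (T := T) hN
  have hSm : MeasurableSet S := by
    classical
    have h1 := hu.continuousOn_off.measurable_piecewise
      (g := fun _ => c + 1) continuousOn_const hG
    have h2 := hu.cont_x.measurable_piecewise (g := fun _ => (0 : ℝ)) continuousOn_const hG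
    have : S = {p | (QT a b T \ NSet N₀ T).piecewise (fun p : ℝ × ℝ => u p.1 p.2)
          (fun _ => c + 1) p = c} ∩
        {p | (QT a b T \ NSet N₀ T).piecewise (fun p : ℝ × ℝ => pdx u p.1 p.2)
          (fun _ => (0 : ℝ)) p = 0}ᶜ := by
      ext p
      by_cases hp : p ∈ QT a b T \ NSet N₀ T
      · simp only [hS, mem_ofPred_eq, mem_inter_iff, mem_compl_iff,
          Set.piecewise_eq_of_mem _ _ _ hp, hp, true_and, ne_eq]
      · simp only [hS, mem_ofPred_eq, mem_inter_iff, mem_compl_iff,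
          Set.piecewise_eq_of_notMem _ _ _ hp, hp, false_and, not_true_eq_false, and_false]
    rw [this]
    exact (measurableSet_eq_fun h1 measurable_const).inter
      (measurableSet_eq_fun h2 measurable_const).compl
  have h0 : volume S = 0 := by
    rw [Measure.volume_eq_prod, Measure.prod_apply_symm hSm, lintegral_eq_zero_iff']
    · refine ae_of_all _ fun t => ?_
      refine Set.Countable.measure_zero
        ((countable_setOf_eq_and_deriv_ne_zero (fun y => u y t) c).mono ?_) _
      rintro x ⟨-, h⟩
      exact h
    · exact (measurable_measure_prodMk_right hSm).aemeasurable
  filter_upwards [ae_restrict_of_ae (measure_eq_zero_iff_ae_notMem.1 h0),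
    ae_restrict_QT_notMem hN] with p hp hp'
  by_contra! hcon
  exact hp ⟨hp', hcon⟩

end Solution

/-- `k` is `C¹` away from `0` with derivative `k'`, and `K` is a primitive of `k` there. -/
structure IsMultiplier (K k k' : ℝ → ℝ) : Prop where
  hasDerivAt_primitive : ∀ s ≠ 0, HasDerivAt K (k s) s
  hasDerivAt : ∀ s ≠ 0, HasDerivAt k (k' s) s
  continuousOn_deriv : ContinuousOn k' {0}ᶜ

/-- `ψ` is `C¹` with partial derivatives `ψx` and `ψt`. -/
structure IsTestFun (ψ ψx ψt : ℝ × ℝ → ℝ) : Prop where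
  cont : Continuous ψ
  cont_x : Continuous ψx
  cont_t : Continuous ψt
  hasDerivAt_x : ∀ x t, HasDerivAt (fun y => ψ (y, t)) (ψx (x, t)) x
  hasDerivAt_t : ∀ x t, HasDerivAt (fun s => ψ (x, s)) (ψt (x, t)) t

/-- The integrand of the weak formulation tested with `k(u) ψ`. -/
noncomputable def energyDensity (K k k' : ℝ → ℝ) (u : ℝ → ℝ → ℝ) (ψ ψx ψt : ℝ × ℝ → ℝ)
    (p : ℝ × ℝ) : ℝ :=
  (Real.sign (u p.1 p.2) * k (u p.1 p.2) + |u p.1 p.2| * k' (u p.1 p.2)) *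
      (pdx u p.1 p.2) ^ 2 * ψ p
    + |u p.1 p.2| * k (u p.1 p.2) * pdx u p.1 p.2 * ψx p
    - u p.1 p.2 * (1 - |u p.1 p.2|) * k (u p.1 p.2) * ψ p
    - K (u p.1 p.2) * ψt p

section Identity

variable {a b T : ℝ} {N₀ : Set ℝ} {u₀ : ℝ → ℝ} {u : ℝ → ℝ → ℝ}
  {K k k' : ℝ → ℝ} {ψ ψx ψt : ℝ × ℝ → ℝ}

theorem IsTestFun.eventually_eq_zero (hψ : IsTestFun ψ ψx ψt) {y : ℝ}
    (h : ∀ᶠ x in 𝓝 y, ∀ t, ψ (x, t) = 0) :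
    ∀ᶠ x in 𝓝 y, ∀ t, ψ (x, t) = 0 ∧ ψx (x, t) = 0 ∧ ψt (x, t) = 0 := by
  filter_upwards [h.eventually_nhds] with x hx t
  have h1 : (fun z => ψ (z, t)) =ᶠ[𝓝 x] fun _ => 0 := hx.mono fun z hz => hz t
  have h2 : (fun s => ψ (x, s)) = fun _ => 0 := funext fun s => hx.self_of_nhds s
  refine ⟨hx.self_of_nhds t, ?_, ?_⟩
  · exact (hψ.hasDerivAt_x x t).unique ((hasDerivAt_const x (0 : ℝ)).congr_of_eventuallyEq h1)
  · have := hψ.hasDerivAt_t x t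
    rw [h2] at this
    exact this.unique (hasDerivAt_const t (0 : ℝ))

/-- The identity obtained by testing the equation with `k(u) ψ`, when this product vanishes near
the degenerate segments and near the lateral boundary. -/
theorem IsClassicalSol.energy_identity (hab : a < b) (hN : N₀.Finite)
    (hu : IsClassicalSol a b T N₀ u₀ u) (hk : IsMultiplier K k k') (hψ : IsTestFun ψ ψx ψt)
    (hbad : ∀ y ∈ insert a (insert b N₀), (∀ᶠ x in 𝓝 y, ∀ t, ψ (x, t) = 0) ∨
      ∀ᶠ x in 𝓝 y, x ∈ Icc a b → ∀ t ∈ Ioc 0 T,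
        K (u x t) = 0 ∧ k (u x t) = 0 ∧ k' (u x t) = 0)
    {ε : ℝ} (hε : 0 < ε) (hεT : ε < T) :
    IntegrableOn (energyDensity K k k' u ψ ψx ψt) (Ioo a b ×ˢ Ioc ε T) ∧
    ∫ p in Ioo a b ×ˢ Ioc ε T, energyDensity K k k' u ψ ψx ψt p =
      ∫ x in Ioo a b, (K (u x ε) * ψ (x, ε) - K (u x T) * ψ (x, T)) := by
  have hZ : ∀ y ∈ insert a (insert b N₀), ∀ᶠ x in 𝓝 y, x ∈ Icc a b → ∀ t ∈ Ioc 0 T,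
      (ψ (x, t) = 0 ∧ ψx (x, t) = 0 ∧ ψt (x, t) = 0) ∨
      (K (u x t) = 0 ∧ k (u x t) = 0 ∧ k' (u x t) = 0) := by
    intro y hy
    rcases hbad y hy with h | h
    · filter_upwards [hψ.eventually_eq_zero h] with x hx _ t _ using Or.inl (hx t)
    · filter_upwards [h] with x hx hx' t ht using Or.inr (hx hx' t ht)
  clear hbad
  have hsub : Icc a b ×ˢ Icc ε T ⊆ Icc a b ×ˢ Ioc 0 T :=
    prod_mono le_rfl fun t ht => ⟨hε.trans_le ht.1, ht.2⟩
  have hcpt : IsCompact (Icc a b ×ˢ Icc ε T) := isCompact_Icc.prod isCompact_Icc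
  have hbox : Ioo a b ×ˢ Ioc ε T ⊆ Icc a b ×ˢ Icc ε T :=
    prod_mono Ioo_subset_Icc_self Ioc_subset_Icc_self
  have hKc : ContinuousOn K {0}ᶜ := fun s hs =>
    (hk.hasDerivAt_primitive s hs).continuousAt.continuousWithinAt
  have hkc : ContinuousOn k {0}ᶜ := fun s hs => (hk.hasDerivAt s hs).continuousAt.continuousWithinAt
  have hmaps : MapsTo (fun p : ℝ × ℝ => u p.1 p.2) (QT a b T \ NSet N₀ T) {0}ᶜ :=
    fun p hp => hu.ne_zero hp
  have hcu := hu.continuousOn_off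
  have hcK : ContinuousOn (fun p : ℝ × ℝ => K (u p.1 p.2)) (QT a b T \ NSet N₀ T) :=
    hKc.comp hcu hmaps
  have hck : ContinuousOn (fun p : ℝ × ℝ => k (u p.1 p.2)) (QT a b T \ NSet N₀ T) :=
    hkc.comp hcu hmaps
  have hck' : ContinuousOn (fun p : ℝ × ℝ => k' (u p.1 p.2)) (QT a b T \ NSet N₀ T) :=
    hk.continuousOn_deriv.comp hcu hmaps
  have hcs : ContinuousOn (fun p : ℝ × ℝ => Real.sign (u p.1 p.2)) (QT a b T \ NSet N₀ T) :=
    Real.continuousOn_sign.comp hcu hmaps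
  have hcx := hu.cont_x
  have hcxx := hu.cont_xx
  have hct := hu.cont_t
  have hψ1 : ContinuousOn ψ (QT a b T \ NSet N₀ T) := hψ.cont.continuousOn
  have hψ2 : ContinuousOn ψx (QT a b T \ NSet N₀ T) := hψ.cont_x.continuousOn
  have hψ3 : ContinuousOn ψt (QT a b T \ NSet N₀ T) := hψ.cont_t.continuousOn
  have hmem : ∀ x ∈ N₀, x ∈ insert a (insert b N₀) := fun x hx => by simp [hx]
  -- the flux, its divergence, and the time derivative
  set F : ℝ × ℝ → ℝ := fun p => |u p.1 p.2| * k (u p.1 p.2) * pdx u p.1 p.2 * ψ p with hF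
  set f₁ : ℝ × ℝ → ℝ := fun p =>
    (Real.sign (u p.1 p.2) * k (u p.1 p.2) + |u p.1 p.2| * k' (u p.1 p.2)) *
      (pdx u p.1 p.2) ^ 2 * ψ p + |u p.1 p.2| * k (u p.1 p.2) * pdxx u p.1 p.2 * ψ p
      + |u p.1 p.2| * k (u p.1 p.2) * pdx u p.1 p.2 * ψx p with hf₁
  set G : ℝ × ℝ → ℝ := fun p => K (u p.1 p.2) * ψ p with hG
  set f₂ : ℝ × ℝ → ℝ := fun p =>
    k (u p.1 p.2) * pdtW T u p.1 p.2 * ψ p + K (u p.1 p.2) * ψt p with hf₂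
  have hFc : ContinuousOn F (Icc a b ×ˢ Icc ε T) := by
    refine (continuousOn_of_vanish_near hN (((hcu.abs.mul hck).mul hcx).mul hψ1) ?_).mono hsub
    intro y hy
    filter_upwards [hZ y hy] with x hx hx' t ht
    rcases hx hx' t ht with h | h <;> simp [h]
  have hf₁c : ContinuousOn f₁ (Icc a b ×ˢ Icc ε T) := by
    refine (continuousOn_of_vanish_near hN (((((hcs.mul hck).add (hcu.abs.mul hck')).mul
      (hcx.pow 2)).mul hψ1).add (((hcu.abs.mul hck).mul hcxx).mul hψ1) |>.add
      (((hcu.abs.mul hck).mul hcx).mul hψ2)) ?_).mono hsub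
    intro y hy
    filter_upwards [hZ y hy] with x hx hx' t ht
    rcases hx hx' t ht with h | h <;> simp [h]
  have hGc : ContinuousOn G (Icc a b ×ˢ Icc ε T) := by
    refine (continuousOn_of_vanish_near hN (hcK.mul hψ1) ?_).mono hsub
    intro y hy
    filter_upwards [hZ y hy] with x hx hx' t ht
    rcases hx hx' t ht with h | h <;> simp [h]
  have hf₂c : ContinuousOn f₂ (Icc a b ×ˢ Icc ε T) := by
    refine (continuousOn_of_vanish_near hN (((hck.mul hct).mul hψ1).add (hcK.mul hψ3)) ?_).mono hsub
    intro y hy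
    filter_upwards [hZ y hy] with x hx hx' t ht
    rcases hx hx' t ht with h | h <;> simp [h]
  have hi₁ : IntegrableOn f₁ (Ioo a b ×ˢ Ioc ε T) :=
    (hf₁c.integrableOn_compact hcpt).mono_set hbox
  have hi₂ : IntegrableOn f₂ (Ioo a b ×ˢ Ioc ε T) :=
    (hf₂c.integrableOn_compact hcpt).mono_set hbox
  have hslice_x : ∀ t ∈ Icc ε T, MapsTo (fun x : ℝ => (x, t)) (Icc a b) (Icc a b ×ˢ Icc ε T) :=
    fun t ht x hx => ⟨hx, ht⟩
  have hslice_t : ∀ x ∈ Icc a b, MapsTo (fun t : ℝ => (x, t)) (Icc ε T) (Icc a b ×ˢ Icc ε T) :=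
    fun x hx t ht => ⟨hx, ht⟩
  -- the divergence integrates to zero on every time slice
  have hdiv : ∀ t ∈ Ioc ε T, ∫ x in Ioo a b, f₁ (x, t) = 0 := by
    intro t ht
    have ht0 : t ∈ Ioc 0 T := ⟨hε.trans ht.1, ht.2⟩
    have ht' := Ioc_subset_Icc_self ht
    have hend : ∀ y ∈ Icc a b, y ∈ insert a (insert b N₀) → F (y, t) = 0 := by
      intro y hy hy'
      rcases (hZ y hy').self_of_nhds hy t ht0 with h | h <;> simp [hF, h]
    rw [← integral_Ioc_eq_integral_Ioo, ← intervalIntegral.integral_of_le hab.le,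
      intervalIntegral.integral_eq_sub_of_hasDerivAt_of_le (f := fun x => F (x, t))
        (f' := fun x => f₁ (x, t)) hab.le
        (hFc.comp (by fun_prop) (hslice_x t ht')) ?_
        ((hf₁c.comp (by fun_prop) (hslice_x t ht')).intervalIntegrable_of_Icc hab.le),
      hend b (right_mem_Icc.2 hab.le) (by simp), hend a (left_mem_Icc.2 hab.le) (by simp), sub_zero]
    intro x hx
    by_cases hxN : x ∈ N₀
    · have h0 : f₁ (x, t) = 0 := by
        rcases (hZ x (hmem x hxN)).self_of_nhds (Ioo_subset_Icc_self hx) t ht0 with h | h <;>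
          simp [hf₁, h]
      rw [h0]
      refine (hasDerivAt_const x (0 : ℝ)).congr_of_eventuallyEq ?_
      filter_upwards [hZ x (hmem x hxN), Ioo_mem_nhds hx.1 hx.2] with z hz hz'
      rcases hz (Ioo_subset_Icc_self hz') t ht0 with h | h <;> simp [hF, h]
    · have hp := mem_QT_diff_NSet hx hxN ht0
      have hne : u x t ≠ 0 := hu.ne_zero hp
      have hd : HasDerivAt (fun y => u y t) (pdx u x t) x := (hu.diff_x _ hp).hasDerivAt
      have hdd : HasDerivAt (fun y => pdx u y t) (pdxx u x t) x := (hu.diff_xx _ hp).hasDerivAt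
      have hda : HasDerivAt (fun y => |u y t|) (Real.sign (u x t) * pdx u x t) x :=
        HasDerivAt.comp (h₂ := fun r : ℝ => |r|) x (Real.hasDerivAt_abs_sign hne) hd
      have hdk : HasDerivAt (fun y => k (u y t)) (k' (u x t) * pdx u x t) x :=
        (hk.hasDerivAt _ hne).comp x hd
      refine (((hda.mul hdk).mul hdd).mul (hψ.hasDerivAt_x x t)).congr_deriv ?_
      simp only [hf₁, Pi.mul_apply]
      ring
  have htime : ∀ x ∈ Ioo a b, ∫ t in Ioc ε T, f₂ (x, t) = G (x, T) - G (x, ε) := by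
    intro x hx
    have hx' := Ioo_subset_Icc_self hx
    rw [← intervalIntegral.integral_of_le hεT.le]
    refine intervalIntegral.integral_eq_sub_of_hasDerivAt_of_le (f := fun t => G (x, t))
        (f' := fun t => f₂ (x, t)) hεT.le
        (hGc.comp (by fun_prop) (hslice_t x hx')) ?_
        ((hf₂c.comp (by fun_prop) (hslice_t x hx')).intervalIntegrable_of_Icc hεT.le)
    intro t ht
    have ht0 : t ∈ Ioc 0 T := ⟨hε.trans ht.1, ht.2.le⟩
    by_cases hxN : x ∈ N₀
    · have hz := (hZ x (hmem x hxN)).self_of_nhds hx'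
      have h0 : f₂ (x, t) = 0 := by
        rcases hz t ht0 with h | h <;> simp [hf₂, h]
      rw [h0]
      refine (hasDerivAt_const t (0 : ℝ)).congr_of_eventuallyEq ?_
      filter_upwards [Ioo_mem_nhds ht.1 ht.2] with s hs
      rcases hz s ⟨hε.trans hs.1, hs.2.le⟩ with h | h <;> simp [hG, h]
    · have hp := mem_QT_diff_NSet hx hxN ht0
      have hne : u x t ≠ 0 := hu.ne_zero hp
      have hd : HasDerivAt (fun s => u x s) (pdtW T u x t) t :=
        (hu.diff_t _ hp).hasDerivWithinAt.hasDerivAt (Iic_mem_nhds ht.2)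
      have hdK : HasDerivAt (fun s => K (u x s)) (k (u x t) * pdtW T u x t) t :=
        (hk.hasDerivAt_primitive _ hne).comp t hd
      exact hdK.mul (hψ.hasDerivAt_t x t)
  have heq : ∀ p ∈ Ioo a b ×ˢ Ioc ε T, energyDensity K k k' u ψ ψx ψt p = f₁ p - f₂ p := by
    rintro ⟨x, t⟩ ⟨hx, ht⟩
    have ht0 : t ∈ Ioc 0 T := ⟨hε.trans ht.1, ht.2⟩
    by_cases hxN : x ∈ N₀
    · rcases (hZ x (hmem x hxN)).self_of_nhds (Ioo_subset_Icc_self hx) t ht0 with h | h <;>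
        simp [hf₁, hf₂, energyDensity, h]
    · have := hu.pde _ (mem_QT_diff_NSet hx hxN ht0)
      simp only [energyDensity, hf₁, hf₂]
      rw [this]
      ring
  have hm : MeasurableSet (Ioo a b ×ˢ Ioc ε T) := measurableSet_Ioo.prod measurableSet_Ioc
  refine ⟨(hi₁.sub hi₂).congr_fun (fun p hp => (heq p hp).symm) hm, ?_⟩
  rw [setIntegral_congr_fun hm heq, integral_sub hi₁ hi₂]
  have h1 : ∫ p in Ioo a b ×ˢ Ioc ε T, f₁ p = 0 := by
    rw [Measure.volume_eq_prod, ← setIntegral_prod_swap, setIntegral_prod]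
    · exact setIntegral_eq_zero_of_forall_eq_zero fun t ht => hdiv t ht
    · exact hi₁.swap
  have h2 : ∫ p in Ioo a b ×ˢ Ioc ε T, f₂ p = ∫ x in Ioo a b, (G (x, T) - G (x, ε)) := by
    rw [Measure.volume_eq_prod, setIntegral_prod _ hi₂]
    exact setIntegral_congr_fun measurableSet_Ioo htime
  rw [h1, h2, zero_sub, ← integral_neg]
  simp only [hG, neg_sub]

end Identity

/-- Pointwise bounds making `w` a lower bound for the dissipation produced by a multiplier. -/
structure EnergyBounds (C : ℝ) (K k k' w : ℝ → ℝ) (s : ℝ) : Prop where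
  nonneg : 0 ≤ w s
  le_dissipation : w s ≤ Real.sign s * k s + |s| * k' s
  sq_le : (|s| * k s) ^ 2 ≤ C * w s
  abs_primitive_le : |K s| ≤ C
  abs_le : |k s| ≤ C

theorem half_dissipation_le {C M E w H k s A e d : ℝ} (hC : 0 ≤ C) (hM : 0 ≤ M) (hw : 0 ≤ w)
    (hH : w ≤ H) (hsq : (|s| * k) ^ 2 ≤ C * w) (hk : |k| ≤ C) (hs : |s| ≤ M) (he : |e| ≤ 1)
    (hd : |d| ≤ E) :
    w * A ^ 2 * e ^ 2 / 2 ≤ H * A ^ 2 * e ^ 2 + |s| * k * A * (2 * e * d)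
      - s * (1 - |s|) * k * e ^ 2 + (M * (1 + M) * C + 2 * C * E ^ 2) := by
  have h1 : w * A ^ 2 * e ^ 2 ≤ H * A ^ 2 * e ^ 2 := by gcongr
  have h2 : |(|s| * k * A * (2 * e * d))| ≤ w * A ^ 2 * e ^ 2 / 2 + 2 * C * d ^ 2 := by
    refine abs_le_of_sq_le_sq ?_ (by positivity)
    have h3 : (|s| * k * A * (2 * e * d)) ^ 2 ≤ C * w * (4 * (A ^ 2 * e ^ 2 * d ^ 2)) := by
      have : (|s| * k * A * (2 * e * d)) ^ 2 = (|s| * k) ^ 2 * (4 * (A ^ 2 * e ^ 2 * d ^ 2)) := by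
        ring
      rw [this]
      gcongr
    nlinarith [sq_nonneg (w * A ^ 2 * e ^ 2 / 2 - 2 * C * d ^ 2)]
  have h4 : d ^ 2 ≤ E ^ 2 := sq_le_sq' (by linarith [abs_le.1 hd]) (abs_le.1 hd).2
  have h5 : |s * (1 - |s|) * k * e ^ 2| ≤ M * (1 + M) * C := by
    have h6 : |(1 - |s|)| ≤ 1 + M := by
      rw [abs_le]
      constructor <;> linarith [abs_nonneg s]
    have h7 : |e ^ 2| ≤ 1 := by rw [abs_pow]; exact pow_le_one₀ (abs_nonneg _) he
    rw [abs_mul, abs_mul, abs_mul]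
    calc |s| * |(1 - |s|)| * |k| * |e ^ 2| ≤ M * (1 + M) * C * 1 := by gcongr
      _ = _ := mul_one _
  have h8 := (abs_le.1 h2).1
  have h9 := (abs_le.1 h5).2
  have h10 : C * d ^ 2 ≤ C * E ^ 2 := by gcongr
  linarith

section EnergyEstimate

variable {a b T : ℝ} {N₀ : Set ℝ} {u₀ : ℝ → ℝ} {u : ℝ → ℝ → ℝ}
  {K k k' w : ℝ → ℝ} {η ηx : ℝ → ℝ}

theorem IsTestFun.sq_of_hasDerivAt (hη : ∀ x, HasDerivAt η (ηx x) x) (hηx : Continuous ηx) :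
    IsTestFun (fun p => η p.1 ^ 2) (fun p => 2 * η p.1 * ηx p.1) (fun _ => 0) := by
  have hc : Continuous η := continuous_iff_continuousAt.2 fun x => (hη x).continuousAt
  refine ⟨by fun_prop, by fun_prop, by fun_prop, fun x t => ?_, fun x t => hasDerivAt_const t (η x ^ 2)⟩
  simpa using (hη x).fun_pow 2

/-- Energy estimate, uniform in the initial time `ε` and in the multiplier. -/
theorem IsClassicalSol.lintegral_energy_le (hab : a < b) (hN : N₀.Finite)
    (hu : IsClassicalSol a b T N₀ u₀ u) {M C E : ℝ} (hM0 : 0 ≤ M) (hC : 0 ≤ C)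
    (hM : ∀ x ∈ Icc a b, ∀ t ∈ Icc (0 : ℝ) T, |u x t| ≤ M)
    (hη : ∀ x, HasDerivAt η (ηx x) x) (hηx : Continuous ηx) (hη1 : ∀ x, |η x| ≤ 1)
    (hE : ∀ x ∈ Icc a b, |ηx x| ≤ E) (hk : IsMultiplier K k k')
    (hw : ∀ x ∈ Ioo a b, ∀ t ∈ Ioc 0 T, η x ≠ 0 → EnergyBounds C K k k' w (u x t))
    (hbad : ∀ y ∈ insert a (insert b N₀), (∀ᶠ x in 𝓝 y, η x = 0) ∨
      ∀ᶠ x in 𝓝 y, x ∈ Icc a b → ∀ t ∈ Ioc 0 T,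
        K (u x t) = 0 ∧ k (u x t) = 0 ∧ k' (u x t) = 0)
    {ε : ℝ} (hε : 0 < ε) (hεT : ε < T) :
    ∫⁻ p in Ioo a b ×ˢ Ioc ε T,
        ENNReal.ofReal (w (u p.1 p.2) * (pdx u p.1 p.2) ^ 2 * η p.1 ^ 2) ≤
      ENNReal.ofReal (2 * (2 * C * (b - a)
        + (M * (1 + M) * C + 2 * C * E ^ 2) * ((b - a) * T))) := by
  have hψ := IsTestFun.sq_of_hasDerivAt hη hηx
  obtain ⟨hi, hid⟩ := hu.energy_identity hab hN hk hψ (fun y hy => (hbad y hy).imp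
    (fun h => h.mono fun x hx t => by simp [hx]) id) hε hεT
  set B := energyDensity K k k' u (fun p => η p.1 ^ 2) (fun p => 2 * η p.1 * ηx p.1) (fun _ => 0)
    with hB
  set C₁ := M * (1 + M) * C + 2 * C * E ^ 2 with hC₁
  have hC₁0 : 0 ≤ C₁ := by positivity
  have hm : MeasurableSet (Ioo a b ×ˢ Ioc ε T) := measurableSet_Ioo.prod measurableSet_Ioc
  have hvol : volume.real (Ioo a b ×ˢ Ioc ε T) = (b - a) * (T - ε) := by
    rw [Measure.volume_eq_prod, measureReal_prod_prod, Real.volume_real_Ioo_of_le hab.le,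
      Real.volume_real_Ioc_of_le hεT.le]
  have hfin : volume (Ioo a b ×ˢ Ioc ε T) < ⊤ := by
    rw [Measure.volume_eq_prod, Measure.prod_prod, Real.volume_Ioo, Real.volume_Ioc]
    exact ENNReal.mul_lt_top ENNReal.ofReal_lt_top ENNReal.ofReal_lt_top
  have hpt : ∀ p ∈ Ioo a b ×ˢ Ioc ε T,
      w (u p.1 p.2) * (pdx u p.1 p.2) ^ 2 * η p.1 ^ 2 ≤ 2 * (B p + C₁) ∧ 0 ≤ 2 * (B p + C₁) := by
    rintro ⟨x, t⟩ ⟨hx, ht⟩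
    have ht0 : t ∈ Ioc 0 T := ⟨hε.trans ht.1, ht.2⟩
    by_cases h0 : η x = 0
    · have : B (x, t) = 0 := by simp [hB, energyDensity, h0]
      rw [this]
      simp only [h0]
      constructor
      · simpa using hC₁0
      · positivity
    · have hw' := hw x hx t ht0 h0
      have := half_dissipation_le (A := pdx u x t) hC hM0 hw'.nonneg hw'.le_dissipation hw'.sq_le
        hw'.abs_le (hM x (Ioo_subset_Icc_self hx) t (Ioc_subset_Icc_self ht0)) (hη1 x)
        (hE x (Ioo_subset_Icc_self hx))
      have hBe : B (x, t) = (Real.sign (u x t) * k (u x t) + |u x t| * k' (u x t)) *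
          pdx u x t ^ 2 * η x ^ 2 + |u x t| * k (u x t) * pdx u x t * (2 * η x * ηx x)
          - u x t * (1 - |u x t|) * k (u x t) * η x ^ 2 := by
        simp [hB, energyDensity]
      have hnn : 0 ≤ w (u x t) * (pdx u x t) ^ 2 * η x ^ 2 :=
        mul_nonneg (mul_nonneg hw'.nonneg (sq_nonneg _)) (sq_nonneg _)
      rw [hBe]
      constructor <;> linarith
  have hiB : IntegrableOn (fun p => 2 * (B p + C₁)) (Ioo a b ×ˢ Ioc ε T) :=
    (hi.add (integrableOn_const hfin.ne)).const_mul 2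
  have hbd : ∫ p in Ioo a b ×ˢ Ioc ε T, B p ≤ 2 * C * (b - a) := by
    rw [hid]
    have := norm_setIntegral_le_of_norm_le_const (μ := volume) (s := Ioo a b) (C := 2 * C)
      (f := fun x => K (u x ε) * η x ^ 2 - K (u x T) * η x ^ 2) (by simp) ?_
    · rw [Real.volume_real_Ioo_of_le hab.le] at this
      exact (le_abs_self _).trans this
    · intro x hx
      by_cases h0 : η x = 0
      · simpa [h0] using hC
      · have h1 := (hw x hx ε ⟨hε, hεT.le⟩ h0).abs_primitive_le
        have h2 := (hw x hx T ⟨hε.trans hεT, le_rfl⟩ h0).abs_primitive_le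
        have h3 : |η x ^ 2| ≤ 1 := by rw [abs_pow]; exact pow_le_one₀ (abs_nonneg _) (hη1 x)
        rw [Real.norm_eq_abs, ← sub_mul, abs_mul]
        calc |K (u x ε) - K (u x T)| * |η x ^ 2| ≤ (C + C) * 1 := by
              gcongr
              exact (abs_sub _ _).trans (add_le_add h1 h2)
          _ = 2 * C := by ring
  calc ∫⁻ p in Ioo a b ×ˢ Ioc ε T,
        ENNReal.ofReal (w (u p.1 p.2) * (pdx u p.1 p.2) ^ 2 * η p.1 ^ 2)
      ≤ ∫⁻ p in Ioo a b ×ˢ Ioc ε T, ENNReal.ofReal (2 * (B p + C₁)) :=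
        setLIntegral_mono' hm fun p hp => ENNReal.ofReal_le_ofReal (hpt p hp).1
    _ = ENNReal.ofReal (∫ p in Ioo a b ×ˢ Ioc ε T, 2 * (B p + C₁)) := by
        rw [ofReal_integral_eq_lintegral_ofReal hiB]
        filter_upwards [ae_restrict_mem hm] with p hp using (hpt p hp).2
    _ ≤ _ := by
        refine ENNReal.ofReal_le_ofReal ?_
        rw [integral_const_mul, integral_add hi (integrableOn_const hfin.ne), setIntegral_const,
          hvol, smul_eq_mul]
        have : (b - a) * (T - ε) * C₁ ≤ C₁ * ((b - a) * T) := by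
          have : 0 ≤ (b - a) * ε * C₁ :=
            mul_nonneg (mul_nonneg (sub_nonneg.2 hab.le) hε.le) hC₁0
          linarith
        linarith

end EnergyEstimate

/-- A smooth even cutoff vanishing for `|s| ≤ δ` and equal to `1` for `s ^ 2 ≥ 2 δ ^ 2`. -/
noncomputable def levelCutoff (δ s : ℝ) : ℝ := Real.smoothTransition (s ^ 2 / δ ^ 2 - 1)

/-- The derivative of `levelCutoff δ`. -/
noncomputable def levelCutoffDeriv (δ s : ℝ) : ℝ :=
  deriv Real.smoothTransition (s ^ 2 / δ ^ 2 - 1) * (2 * s / δ ^ 2)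

section Cutoff

variable {δ s : ℝ}

theorem Real.smoothTransition.deriv_eq_zero_of_neg {r : ℝ} (hr : r < 0) :
    deriv Real.smoothTransition r = 0 := by
  have : Real.smoothTransition =ᶠ[𝓝 r] fun _ => 0 := by
    filter_upwards [Iio_mem_nhds hr] with z hz
    exact Real.smoothTransition.zero_of_nonpos (le_of_lt hz)
  rw [this.deriv_eq, deriv_const]

theorem Real.smoothTransition.deriv_eq_zero_of_one_lt {r : ℝ} (hr : 1 < r) :
    deriv Real.smoothTransition r = 0 := by
  have : Real.smoothTransition =ᶠ[𝓝 r] fun _ => 1 := by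
    filter_upwards [Ioi_mem_nhds hr] with z hz
    exact Real.smoothTransition.one_of_one_le (le_of_lt hz)
  rw [this.deriv_eq, deriv_const]

theorem Real.smoothTransition.continuous_deriv : Continuous (deriv Real.smoothTransition) :=
  (Real.smoothTransition.contDiff (n := 1)).continuous_deriv le_rfl

theorem levelCutoff_nonneg (δ s : ℝ) : 0 ≤ levelCutoff δ s := Real.smoothTransition.nonneg _

theorem levelCutoff_le_one (δ s : ℝ) : levelCutoff δ s ≤ 1 := Real.smoothTransition.le_one _

theorem abs_levelCutoff_le_one (δ s : ℝ) : |levelCutoff δ s| ≤ 1 := by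
  rw [abs_of_nonneg (levelCutoff_nonneg δ s)]
  exact levelCutoff_le_one δ s

theorem levelCutoff_sq_le (δ s : ℝ) : levelCutoff δ s ^ 2 ≤ levelCutoff δ s := by
  nlinarith [levelCutoff_nonneg δ s, levelCutoff_le_one δ s]

theorem continuous_levelCutoff (δ : ℝ) : Continuous (levelCutoff δ) :=
  Real.smoothTransition.continuous.comp (by fun_prop)

theorem continuous_levelCutoffDeriv (δ : ℝ) : Continuous (levelCutoffDeriv δ) :=
  (Real.smoothTransition.continuous_deriv.comp (by fun_prop)).mul (by fun_prop)

theorem hasDerivAt_levelCutoff (δ s : ℝ) :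
    HasDerivAt (levelCutoff δ) (levelCutoffDeriv δ s) s := by
  have h1 : HasDerivAt (fun r : ℝ => r ^ 2 / δ ^ 2 - 1) (2 * s / δ ^ 2) s := by
    simpa using ((hasDerivAt_pow 2 s).div_const (δ ^ 2)).sub_const 1
  have h2 : HasDerivAt Real.smoothTransition (deriv Real.smoothTransition (s ^ 2 / δ ^ 2 - 1))
      (s ^ 2 / δ ^ 2 - 1) :=
    ((Real.smoothTransition.contDiff (n := 1)).differentiable one_ne_zero _).hasDerivAt
  exact h2.comp s h1

theorem sq_div_sq_sub_one_neg (h : |s| < δ) : s ^ 2 / δ ^ 2 - 1 < 0 := by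
  have hδ : 0 < δ := (abs_nonneg s).trans_lt h
  rw [sub_neg, div_lt_one (by positivity)]
  exact sq_lt_sq' (by linarith [abs_lt.1 h]) (abs_lt.1 h).2

theorem levelCutoff_eq_zero (h : |s| < δ) : levelCutoff δ s = 0 :=
  Real.smoothTransition.zero_of_nonpos (sq_div_sq_sub_one_neg h).le

theorem levelCutoffDeriv_eq_zero (h : |s| < δ) : levelCutoffDeriv δ s = 0 := by
  rw [levelCutoffDeriv, Real.smoothTransition.deriv_eq_zero_of_neg (sq_div_sq_sub_one_neg h),
    zero_mul]

theorem levelCutoff_eq_one (hδ : 0 < δ) (h : 2 * δ ^ 2 < s ^ 2) : levelCutoff δ s = 1 := by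
  refine Real.smoothTransition.one_of_one_le ?_
  rw [le_sub_iff_add_le, le_div_iff₀ (by positivity)]
  linarith

theorem levelCutoffDeriv_eq_zero_of_lt (hδ : 0 < δ) (h : 2 * δ ^ 2 < s ^ 2) :
    levelCutoffDeriv δ s = 0 := by
  rw [levelCutoffDeriv, Real.smoothTransition.deriv_eq_zero_of_one_lt, zero_mul]
  rw [lt_sub_iff_add_lt, lt_div_iff₀ (by positivity)]
  linarith

theorem mul_levelCutoffDeriv (δ s : ℝ) : s * levelCutoffDeriv δ s =
    2 * (s ^ 2 / δ ^ 2) * deriv Real.smoothTransition (s ^ 2 / δ ^ 2 - 1) := by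
  rw [levelCutoffDeriv]
  ring

theorem mul_levelCutoffDeriv_nonneg (δ s : ℝ) : 0 ≤ s * levelCutoffDeriv δ s := by
  rw [mul_levelCutoffDeriv]
  exact mul_nonneg (by positivity) Real.smoothTransition.monotone.deriv_nonneg

theorem exists_mul_levelCutoffDeriv_le :
    ∃ C, 0 ≤ C ∧ ∀ δ s, |s * levelCutoffDeriv δ s| ≤ C := by
  obtain ⟨C, hC⟩ := isCompact_Icc.exists_bound_of_continuousOn (s := Icc (0 : ℝ) 1)
    Real.smoothTransition.continuous_deriv.continuousOn
  have hC0 : 0 ≤ C := (norm_nonneg _).trans (hC 0 (by simp))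
  refine ⟨4 * C, by positivity, fun δ s => ?_⟩
  rw [mul_levelCutoffDeriv]
  set r := s ^ 2 / δ ^ 2 - 1 with hr
  rw [show s ^ 2 / δ ^ 2 = r + 1 by rw [hr]; ring]
  by_cases h : r ∈ Icc (0 : ℝ) 1
  · have h1 : |2 * (r + 1)| ≤ 4 := by
      rw [abs_of_nonneg (by linarith [h.1])]
      linarith [h.2]
    rw [abs_mul]
    exact mul_le_mul h1 (hC r h) (abs_nonneg _) (by norm_num)
  · have h0 : deriv Real.smoothTransition r = 0 := by
      rw [mem_Icc, not_and_or, not_le, not_le] at h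
      exact h.elim Real.smoothTransition.deriv_eq_zero_of_neg
        Real.smoothTransition.deriv_eq_zero_of_one_lt
    rw [h0, mul_zero, abs_zero]
    positivity

theorem Continuous.hasDerivAt_primitive {f : ℝ → ℝ} (hf : Continuous f) (s : ℝ) :
    HasDerivAt (fun s => ∫ r in (0 : ℝ)..s, f r) (f s) s :=
  intervalIntegral.integral_hasDerivAt_right (hf.intervalIntegrable _ _)
    (hf.stronglyMeasurableAtFilter _ _) hf.continuousAt

theorem abs_le_of_mem_uIoc_zero {r : ℝ} (hr : r ∈ Set.uIoc 0 s) : |r| ≤ |s| := by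
  simpa using Set.abs_sub_left_of_mem_uIcc (Set.uIoc_subset_uIcc hr)

theorem primitive_eq_zero {f : ℝ → ℝ} (hf : ∀ r, |r| < δ → f r = 0) (h : |s| < δ) :
    ∫ r in (0 : ℝ)..s, f r = 0 :=
  intervalIntegral.integral_zero_ae <| ae_of_all _ fun r hr =>
    hf r ((abs_le_of_mem_uIoc_zero hr).trans_lt h)

theorem abs_primitive_levelCutoff_sub_le (δ r s : ℝ) :
    |(∫ z in (0 : ℝ)..s, levelCutoff δ z) - ∫ z in (0 : ℝ)..r, levelCutoff δ z| ≤ |s - r| := by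
  rw [intervalIntegral.integral_interval_sub_left
    ((continuous_levelCutoff δ).intervalIntegrable _ _)
    ((continuous_levelCutoff δ).intervalIntegrable _ _)]
  simpa using intervalIntegral.norm_integral_le_of_norm_le_const (a := r) (b := s) (C := 1)
    (f := levelCutoff δ) fun z _ => abs_levelCutoff_le_one δ z

theorem abs_primitive_levelCutoff_le (δ s : ℝ) :
    |∫ z in (0 : ℝ)..s, levelCutoff δ z| ≤ |s| := by
  simpa using abs_primitive_levelCutoff_sub_le δ 0 s

theorem eventually_two_mul_sq_lt {d : ℕ → ℝ} (hd : Tendsto d atTop (𝓝 0)) (hs : s ≠ 0) :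
    ∀ᶠ n in atTop, 2 * d n ^ 2 < s ^ 2 := by
  have : Tendsto (fun n => 2 * d n ^ 2) atTop (𝓝 (2 * 0 ^ 2)) := (hd.pow 2).const_mul 2
  refine this.eventually_lt_const ?_
  have : 0 < s ^ 2 := by positivity
  linarith

theorem tendsto_primitive_levelCutoff {d : ℕ → ℝ} (hd0 : ∀ n, 0 < d n)
    (hd : Tendsto d atTop (𝓝 0)) {σ : ℕ → ℝ} (hσ : Tendsto σ atTop (𝓝 s)) :
    Tendsto (fun n => ∫ r in (0 : ℝ)..σ n, levelCutoff (d n) r) atTop (𝓝 s) := by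
  have h1 : Tendsto (fun n => ∫ r in (0 : ℝ)..s, levelCutoff (d n) r) atTop
      (𝓝 (∫ _ in (0 : ℝ)..s, (1 : ℝ))) := by
    refine intervalIntegral.tendsto_integral_filter_of_dominated_convergence (fun _ => 1)
      (Eventually.of_forall fun n => (continuous_levelCutoff _).aestronglyMeasurable)
      (Eventually.of_forall fun n => ae_of_all _ fun r _ => abs_levelCutoff_le_one _ r)
      intervalIntegrable_const ?_
    filter_upwards [Measure.ae_ne volume (0 : ℝ)] with r hr _
    refine tendsto_const_nhds.congr' ?_
    filter_upwards [eventually_two_mul_sq_lt hd hr] with n hn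
    exact (levelCutoff_eq_one (hd0 n) hn).symm
  have h2 : Tendsto (fun n => (∫ r in (0 : ℝ)..σ n, levelCutoff (d n) r)
      - ∫ r in (0 : ℝ)..s, levelCutoff (d n) r) atTop (𝓝 0) := by
    refine squeeze_zero_norm (fun n => abs_primitive_levelCutoff_sub_le (d n) s (σ n)) ?_
    simpa using (hσ.sub_const s).abs
  simpa using h2.add h1

theorem isMultiplier_levelCutoff (δ : ℝ) :
    IsMultiplier (fun s => ∫ r in (0 : ℝ)..s, levelCutoff δ r) (levelCutoff δ)
      (levelCutoffDeriv δ) where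
  hasDerivAt_primitive s _ := (continuous_levelCutoff δ).hasDerivAt_primitive s
  hasDerivAt s _ := hasDerivAt_levelCutoff δ s
  continuousOn_deriv := (continuous_levelCutoffDeriv δ).continuousOn

theorem IsMultiplier.sign_mul {K k k' : ℝ → ℝ} (h : IsMultiplier K k k') :
    IsMultiplier (fun s => Real.sign s * K s) (fun s => Real.sign s * k s)
      (fun s => Real.sign s * k' s) where
  hasDerivAt_primitive s hs := (h.hasDerivAt_primitive s hs).sign_mul hs
  hasDerivAt s hs := (h.hasDerivAt s hs).sign_mul hs
  continuousOn_deriv := Real.continuousOn_sign.mul h.continuousOn_deriv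

theorem isMultiplier_shifted_levelCutoff (δ c : ℝ) :
    IsMultiplier (fun s => ∫ r in (0 : ℝ)..(s - c), r * levelCutoff δ r)
      (fun s => (s - c) * levelCutoff δ (s - c))
      (fun s => levelCutoff δ (s - c) + (s - c) * levelCutoffDeriv δ (s - c)) where
  hasDerivAt_primitive s _ :=
    ((continuous_id.mul (continuous_levelCutoff δ)).hasDerivAt_primitive (s - c)).comp_sub_const s c
  hasDerivAt s _ := by
    have h1 : HasDerivAt (fun s => s - c) 1 s := (hasDerivAt_id s).sub_const c
    simpa using h1.fun_mul ((hasDerivAt_levelCutoff δ (s - c)).comp_sub_const s c)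
  continuousOn_deriv := by
    have h1 := continuous_levelCutoff δ
    have h2 := continuous_levelCutoffDeriv δ
    exact Continuous.continuousOn (by fun_prop)

theorem energyBounds_sign_levelCutoff {M : ℝ} (hM : 0 ≤ M) (hs : |s| ≤ M) :
    EnergyBounds (2 * (M + 1) ^ 4)
      (fun s => Real.sign s * ∫ r in (0 : ℝ)..s, levelCutoff δ r)
      (fun s => Real.sign s * levelCutoff δ s) (fun s => Real.sign s * levelCutoffDeriv δ s)
      (fun s => levelCutoff δ s) s := by
  have h0 := levelCutoff_nonneg δ s
  have hone : 1 ≤ (M + 1) ^ 4 := one_le_pow₀ (by linarith)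
  have hMle : M + 1 ≤ (M + 1) ^ 4 := le_self_pow₀ (by linarith) (by norm_num)
  have hMsq : (M + 1) ^ 2 ≤ (M + 1) ^ 4 := pow_le_pow_right₀ (by linarith) (by norm_num)
  have hsgn := Real.abs_sign_le_one s
  refine ⟨h0, ?_, ?_, ?_, ?_⟩
  · rcases lt_trichotomy s 0 with h | h | h
    · have := mul_levelCutoffDeriv_nonneg δ s
      simp only [Real.sign_of_neg h, abs_of_neg h]
      linarith
    · subst h
      simp [levelCutoff, Real.smoothTransition.zero_of_nonpos]
    · have := mul_levelCutoffDeriv_nonneg δ s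
      simp only [Real.sign_of_pos h, abs_of_pos h]
      linarith
  · have h1 : (Real.sign s) ^ 2 ≤ 1 := (sq_le_one_iff_abs_le_one _).2 hsgn
    have h2 : |s| ^ 2 ≤ M ^ 2 := by gcongr
    calc (|s| * (Real.sign s * levelCutoff δ s)) ^ 2
        = |s| ^ 2 * Real.sign s ^ 2 * levelCutoff δ s ^ 2 := by ring
      _ ≤ M ^ 2 * 1 * levelCutoff δ s := by
          gcongr
          exact levelCutoff_sq_le δ s
      _ ≤ 2 * (M + 1) ^ 4 * levelCutoff δ s := by
          refine mul_le_mul_of_nonneg_right ?_ h0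
          nlinarith
  · calc |Real.sign s * ∫ r in (0 : ℝ)..s, levelCutoff δ r|
        = |Real.sign s| * |∫ r in (0 : ℝ)..s, levelCutoff δ r| := abs_mul _ _
      _ ≤ 1 * M := by
          gcongr
          exact (abs_primitive_levelCutoff_le δ s).trans hs
      _ ≤ 2 * (M + 1) ^ 4 := by linarith
  · calc |Real.sign s * levelCutoff δ s| = |Real.sign s| * |levelCutoff δ s| := abs_mul _ _
      _ ≤ 1 * 1 := by
          gcongr
          exact abs_levelCutoff_le_one δ s
      _ ≤ 2 * (M + 1) ^ 4 := by linarith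

theorem energyBounds_shifted_levelCutoff {M c : ℝ} (hM : 0 ≤ M) (hs : |s| ≤ M)
    (hc : |c| = 1) (hcs : 3 / 4 ≤ c * s) :
    EnergyBounds (2 * (M + 1) ^ 4)
      (fun s => ∫ r in (0 : ℝ)..(s - c), r * levelCutoff δ r)
      (fun s => (s - c) * levelCutoff δ (s - c))
      (fun s => levelCutoff δ (s - c) + (s - c) * levelCutoffDeriv δ (s - c))
      (fun s => levelCutoff δ (s - c) / 2) s := by
  have h0 := levelCutoff_nonneg δ (s - c)
  have hone : 1 ≤ (M + 1) ^ 4 := one_le_pow₀ (by linarith)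
  have hMle : M + 1 ≤ (M + 1) ^ 4 := le_self_pow₀ (by linarith) (by norm_num)
  have hMsq : (M + 1) ^ 2 ≤ (M + 1) ^ 4 := pow_le_pow_right₀ (by linarith) (by norm_num)
  have hsc : |s - c| ≤ M + 1 := (abs_sub _ _).trans (by linarith)
  refine ⟨by positivity, ?_, ?_, ?_, ?_⟩
  · have h1 := mul_levelCutoffDeriv_nonneg δ (s - c)
    have h2 : 0 ≤ |s| * ((s - c) * levelCutoffDeriv δ (s - c)) := mul_nonneg (abs_nonneg _) h1
    have h3 : Real.sign s * (s - c) = |s| - 1 ∧ 3 / 4 ≤ |s| := by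
      rcases (abs_eq zero_le_one).1 hc with rfl | rfl
      · have : 0 < s := by linarith
        rw [Real.sign_of_pos this, abs_of_pos this]
        constructor <;> linarith
      · have : s < 0 := by linarith
        rw [Real.sign_of_neg this, abs_of_neg this]
        constructor <;> linarith
    have h4 : Real.sign s * ((s - c) * levelCutoff δ (s - c))
        = (|s| - 1) * levelCutoff δ (s - c) := by rw [← mul_assoc, h3.1]
    rw [h4]
    nlinarith [mul_nonneg (sub_nonneg.2 h3.2) h0]
  · have h2 : |s| ^ 2 ≤ (M + 1) ^ 2 := by
      gcongr
      linarith
    have h3 : (s - c) ^ 2 ≤ (M + 1) ^ 2 := sq_le_sq' (by linarith [abs_le.1 hsc]) (abs_le.1 hsc).2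
    calc (|s| * ((s - c) * levelCutoff δ (s - c))) ^ 2
        = |s| ^ 2 * (s - c) ^ 2 * levelCutoff δ (s - c) ^ 2 := by ring
      _ ≤ (M + 1) ^ 2 * (M + 1) ^ 2 * levelCutoff δ (s - c) := by
          gcongr
          exact levelCutoff_sq_le δ _
      _ = 2 * (M + 1) ^ 4 * (levelCutoff δ (s - c) / 2) := by ring
  · have h4 := intervalIntegral.norm_integral_le_of_norm_le_const (a := 0) (b := s - c)
      (C := M + 1) (f := fun r => r * levelCutoff δ r) (by
        intro r hr
        rw [Real.norm_eq_abs, abs_mul]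
        calc |r| * |levelCutoff δ r| ≤ (M + 1) * 1 := by
              gcongr
              · exact (abs_le_of_mem_uIoc_zero hr).trans hsc
              · exact abs_levelCutoff_le_one δ r
          _ = M + 1 := mul_one _)
    rw [sub_zero, Real.norm_eq_abs] at h4
    have h5 : (M + 1) * |s - c| ≤ (M + 1) * (M + 1) := by gcongr
    nlinarith
  · rw [abs_mul]
    calc |s - c| * |levelCutoff δ (s - c)| ≤ (M + 1) * 1 := by
          gcongr
          exact abs_levelCutoff_le_one δ _
      _ ≤ 2 * (M + 1) ^ 4 := by linarith

end Cutoff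

section GradientSquare

variable {a b T : ℝ} {N₀ : Set ℝ} {u₀ : ℝ → ℝ} {u : ℝ → ℝ → ℝ}

theorem ContinuousOn.aestronglyMeasurable_QT (hN : N₀.Finite) {f : ℝ × ℝ → ℝ}
    (hf : ContinuousOn f (QT a b T \ NSet N₀ T)) :
    AEStronglyMeasurable f (volume.restrict (QT a b T)) := by
  have h1 := hf.aestronglyMeasurable (μ := volume) (measurableSet_QT_diff_NSet hN)
  have h2 : (volume.restrict (QT a b T)).restrict (QT a b T \ NSet N₀ T)
      = volume.restrict (QT a b T) :=
    Measure.restrict_eq_self_of_ae_mem (ae_restrict_QT_notMem hN)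
  rwa [← h2, Measure.restrict_restrict (measurableSet_QT_diff_NSet hN),
    inter_eq_left.2 sdiff_subset]

theorem tendsto_div_nat_add_two (T : ℝ) :
    Tendsto (fun n : ℕ => T / ((n : ℝ) + 2)) atTop (𝓝 0) :=
  tendsto_const_nhds.div_atTop (tendsto_atTop_add_const_right _ _ tendsto_natCast_atTop_atTop)

theorem div_nat_add_two_mem (hT : 0 < T) (n : ℕ) :
    0 < T / ((n : ℝ) + 2) ∧ T / ((n : ℝ) + 2) < T :=
  ⟨by positivity, div_lt_self hT (by linarith [n.cast_nonneg (α := ℝ)])⟩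

theorem IsClassicalSol.integrableOn_pdx_sq_mul_of_lintegral_le (hN : N₀.Finite)
    (hu : IsClassicalSol a b T N₀ u₀ u) {w : ℕ → ℝ → ℝ} {c m D : ℝ} {η : ℝ → ℝ}
    (hwc : ∀ n, Continuous (w n)) (hm : 0 < m) (hwm : ∀ s ≠ c, ∀ᶠ n in atTop, w n s = m)
    (hη : Continuous η)
    (hD : ∀ n : ℕ, ∫⁻ p in Ioo a b ×ˢ Ioc (T / (n + 2)) T,
      ENNReal.ofReal (w n (u p.1 p.2) * (pdx u p.1 p.2) ^ 2 * η p.1 ^ 2) ≤ ENNReal.ofReal D) :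
    IntegrableOn (fun p => (pdx u p.1 p.2) ^ 2 * η p.1 ^ 2) (QT a b T) := by
  have hηc : Continuous fun p : ℝ × ℝ => η p.1 ^ 2 := (hη.comp continuous_fst).pow 2
  have hms : ∀ n : ℕ, MeasurableSet (Ioo a b ×ˢ Ioc (T / ((n : ℝ) + 2)) T) := fun n =>
    measurableSet_Ioo.prod measurableSet_Ioc
  set F : ℕ → ℝ × ℝ → ENNReal := fun n => (Ioo a b ×ˢ Ioc (T / ((n : ℝ) + 2)) T).indicator
    fun p => ENNReal.ofReal (w n (u p.1 p.2) * (pdx u p.1 p.2) ^ 2 * η p.1 ^ 2) with hF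
  have hFm : ∀ n, AEMeasurable (F n) (volume.restrict (QT a b T)) := fun n => by
    have h1 : ContinuousOn (fun p : ℝ × ℝ =>
        w n (u p.1 p.2) * (pdx u p.1 p.2) ^ 2 * η p.1 ^ 2) (QT a b T \ NSet N₀ T) :=
      (((hwc n).comp_continuousOn hu.continuousOn_off).mul (hu.cont_x.pow 2)).mul
        hηc.continuousOn
    exact (h1.aestronglyMeasurable_QT hN).aemeasurable.ennreal_ofReal.indicator (hms n)
  have hle : ∫⁻ p in QT a b T, ENNReal.ofReal (m * ((pdx u p.1 p.2) ^ 2 * η p.1 ^ 2))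
      ≤ ENNReal.ofReal D := by
    calc _ ≤ ∫⁻ p in QT a b T, liminf (fun n => F n p) atTop := by
          refine lintegral_mono_ae ?_
          filter_upwards [hu.ae_ne_or_pdx_eq_zero hN c,
            ae_restrict_mem (measurableSet_Ioo.prod measurableSet_Ioc)] with p hp hpQ
          rcases hp with hp | hp
          · refine le_liminf_of_le (by isBoundedDefault) ?_
            filter_upwards [hwm _ hp, (tendsto_div_nat_add_two T).eventually_lt_const hpQ.2.1] with n h1 h2
            rw [hF]
            simp only
            rw [indicator_of_mem (show p ∈ Ioo a b ×ˢ Ioc (T / ((n : ℝ) + 2)) T from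
              ⟨hpQ.1, h2, hpQ.2.2⟩), h1, mul_assoc]
          · simp [hp]
      _ ≤ liminf (fun n => ∫⁻ p in QT a b T, F n p) atTop := lintegral_liminf_le' hFm
      _ ≤ ENNReal.ofReal D := by
          refine liminf_le_of_le (by isBoundedDefault) fun x hx => ?_
          obtain ⟨n, hn⟩ := hx.exists
          have h1 := setLIntegral_indicator (μ := volume) (hms n) (t := QT a b T) (fun p =>
            ENNReal.ofReal (w n (u p.1 p.2) * (pdx u p.1 p.2) ^ 2 * η p.1 ^ 2))
          exact hn.trans (h1.trans_le ((lintegral_mono_set inter_subset_left).trans (hD n)))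
  have hc : ContinuousOn (fun p : ℝ × ℝ => (pdx u p.1 p.2) ^ 2 * η p.1 ^ 2)
      (QT a b T \ NSet N₀ T) := (hu.cont_x.pow 2).mul hηc.continuousOn
  have hi : IntegrableOn (fun p => m * ((pdx u p.1 p.2) ^ 2 * η p.1 ^ 2)) (QT a b T) := by
    refine ⟨(hc.aestronglyMeasurable_QT hN).const_mul m, ?_⟩
    rw [hasFiniteIntegral_iff_ofReal (ae_of_all _ fun p => by positivity)]
    exact hle.trans_lt ENNReal.ofReal_lt_top
  exact (integrable_const_mul_iff hm.ne'.isUnit _).1 hi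

theorem IsClassicalSol.integrableOn_pdx_sq_mul_sq (hab : a < b) (hT : 0 < T) (hN : N₀.Finite)
    (hu : IsClassicalSol a b T N₀ u₀ u) {η : ℝ → ℝ} (hη : ContDiff ℝ 1 η) (hη1 : ∀ x, |η x| ≤ 1)
    {K k k' w : ℝ → ℝ → ℝ} {C c m : ℝ} (hC : 0 ≤ C) (hm : 0 < m)
    (hk : ∀ δ, IsMultiplier (K δ) (k δ) (k' δ))
    (hw : ∀ δ, ∀ x ∈ Ioo a b, ∀ t ∈ Ioc 0 T, η x ≠ 0 →
      EnergyBounds C (K δ) (k δ) (k' δ) (w δ) (u x t))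
    (hbad : ∀ δ > 0, ∀ y ∈ insert a (insert b N₀), (∀ᶠ x in 𝓝 y, η x = 0) ∨
      ∀ᶠ x in 𝓝 y, x ∈ Icc a b → ∀ t ∈ Ioc 0 T,
        K δ (u x t) = 0 ∧ k δ (u x t) = 0 ∧ k' δ (u x t) = 0)
    (hwc : ∀ δ, Continuous (w δ))
    (hwm : ∀ s ≠ c, ∀ᶠ n : ℕ in atTop, w (1 / ((n : ℝ) + 1)) s = m) :
    IntegrableOn (fun p => (pdx u p.1 p.2) ^ 2 * η p.1 ^ 2) (QT a b T) := by
  obtain ⟨M, hM⟩ := hu.exists_bound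
  have hM0 : 0 ≤ M := (abs_nonneg _).trans
    (hM a (left_mem_Icc.2 hab.le) 0 (left_mem_Icc.2 hT.le))
  have hηd := hη.continuous_deriv le_rfl
  obtain ⟨E, hE⟩ := isCompact_Icc.exists_bound_of_continuousOn (s := Icc a b) hηd.continuousOn
  refine hu.integrableOn_pdx_sq_mul_of_lintegral_le hN (w := fun n => w (1 / ((n : ℝ) + 1)))
    (fun n => hwc _) hm hwm hη.continuous fun n =>
    hu.lintegral_energy_le hab hN hM0 hC hM
      (fun x => (hη.differentiable one_ne_zero x).hasDerivAt) hηd hη1 hE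
      (hk _) (hw _) (hbad _ (by positivity)) (div_nat_add_two_mem hT n).1
      (div_nat_add_two_mem hT n).2

theorem eventually_levelCutoff_eq_one {s : ℝ} (hs : s ≠ 0) :
    ∀ᶠ n : ℕ in atTop, levelCutoff (1 / ((n : ℝ) + 1)) s = 1 := by
  filter_upwards [eventually_two_mul_sq_lt tendsto_one_div_add_atTop_nhds_zero_nat hs] with n hn
  exact levelCutoff_eq_one (by positivity) hn

theorem ContDiffBump.abs_le_one {y : ℝ} (f : ContDiffBump y) (x : ℝ) : |f x| ≤ 1 := by
  rw [abs_of_nonneg f.nonneg]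
  exact f.le_one

theorem ContDiffBump.eventually_eq_zero {y z : ℝ} (f : ContDiffBump y) (h : f.rOut < dist z y) :
    ∀ᶠ x in 𝓝 z, f x = 0 := by
  have : ∀ᶠ x in 𝓝 z, f.rOut < dist x y :=
    (continuous_id.dist continuous_const).continuousAt.eventually_const_lt h
  exact this.mono fun x hx => f.zero_of_le_dist hx.le

theorem IntegrableOn.pdx_sq_of_bump {y r : ℝ} (f : ContDiffBump y) (hr : r ≤ f.rIn)
    (hi : IntegrableOn (fun p => (pdx u p.1 p.2) ^ 2 * f p.1 ^ 2) (QT a b T)) :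
    IntegrableOn (fun p => (pdx u p.1 p.2) ^ 2) ((Ioo a b ∩ Metric.ball y r) ×ˢ Ioc 0 T) := by
  refine (hi.mono_set (prod_mono inter_subset_left Subset.rfl)).congr_fun (fun p hp => ?_)
    ((measurableSet_Ioo.inter measurableSet_ball).prod measurableSet_Ioc)
  have : f p.1 = 1 := f.one_of_mem_closedBall
    (Metric.closedBall_subset_closedBall hr (Metric.ball_subset_closedBall hp.1.2))
  simp [this]

theorem IsClassicalSol.exists_integrableOn_pdx_sq_near_endpoint (hab : a < b) (hT : 0 < T)
    (hN : N₀.Finite) (hu : IsClassicalSol a b T N₀ u₀ u) {y c : ℝ} (hy : y ∈ Icc a b)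
    (hc : |c| = 1) (hyc : ∀ t ∈ Ioc 0 T, u y t = c)
    (hsep : ∀ z ∈ insert a (insert b N₀), z ∈ Icc a b ∧ (z = y ∨ c * u z T ≤ 0)) :
    ∃ r > 0, IntegrableOn (fun p => (pdx u p.1 p.2) ^ 2)
      ((Ioo a b ∩ Metric.ball y r) ×ˢ Ioc 0 T) := by
  obtain ⟨r, hr, h⟩ := hu.eventually_abs_sub_lt hy (show (0 : ℝ) < 1 / 4 by norm_num)
  have hcc : c * c = 1 := by rw [← abs_mul_abs_self, hc, one_mul]
  have hlow : ∀ x ∈ Icc a b, |x - y| < r → ∀ t ∈ Ioc 0 T, 3 / 4 ≤ c * u x t := by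
    intro x hx hxy t ht
    have h1 : |c * u x t - 1| < 1 / 4 := by
      have h2 := h x hx hxy t (Ioc_subset_Icc_self ht)
      rw [hyc t ht] at h2
      have h3 : c * u x t - 1 = c * (u x t - c) := by rw [mul_sub, hcc]
      rwa [h3, abs_mul, hc, one_mul]
    linarith [(abs_lt.1 h1).1]
  obtain ⟨M, hM⟩ := hu.exists_bound
  have hM0 : 0 ≤ M := (abs_nonneg _).trans
    (hM a (left_mem_Icc.2 hab.le) 0 (left_mem_Icc.2 hT.le))
  let f : ContDiffBump y := ⟨r / 4, r / 2, by positivity, by linarith⟩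
  refine ⟨r / 4, by positivity, IntegrableOn.pdx_sq_of_bump f le_rfl ?_⟩
  refine hu.integrableOn_pdx_sq_mul_sq hab hT hN f.contDiff f.abs_le_one
    (C := 2 * (M + 1) ^ 4) (c := c) (m := 1 / 2) (by positivity) (by norm_num)
    (fun δ => isMultiplier_shifted_levelCutoff δ c)
    (w := fun δ s => levelCutoff δ (s - c) / 2) ?_ ?_ ?_ ?_
  · intro δ x hx t ht hfx
    have hxr : |x - y| < r := by
      by_contra! hge
      refine hfx (f.zero_of_le_dist (le_trans ?_ hge))
      change r / 2 ≤ r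
      linarith
    exact energyBounds_shifted_levelCutoff hM0
      (hM x (Ioo_subset_Icc_self hx) t (Ioc_subset_Icc_self ht)) hc
      (hlow x (Ioo_subset_Icc_self hx) hxr t ht)
  · intro δ hδ z hz
    obtain ⟨hz1, rfl | hz2⟩ := hsep z hz
    · right
      obtain ⟨ρ, hρ, hρu⟩ := hu.eventually_abs_sub_lt hy hδ
      filter_upwards [Metric.ball_mem_nhds z hρ] with x hx hxI t ht
      have hlt : |u x t - c| < δ := by
        rw [← hyc t ht]
        exact hρu x hxI (by simpa [Real.dist_eq] using hx) t (Ioc_subset_Icc_self ht)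
      refine ⟨primitive_eq_zero (fun q hq => ?_) hlt, ?_, ?_⟩
      · rw [levelCutoff_eq_zero hq, mul_zero]
      · rw [levelCutoff_eq_zero hlt, mul_zero]
      · rw [levelCutoff_eq_zero hlt, levelCutoffDeriv_eq_zero hlt, mul_zero, add_zero]
    · left
      refine f.eventually_eq_zero ?_
      change r / 2 < |z - y|
      by_contra! hle
      linarith [hlow z hz1 (by linarith) T ⟨hT, le_rfl⟩]
  · intro δ
    have := continuous_levelCutoff δ
    fun_prop
  · intro s hs
    filter_upwards [eventually_levelCutoff_eq_one (sub_ne_zero.2 hs)] with n hn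
    rw [hn]

theorem IsClassicalSol.integrableOn_pdx_sq_interior (hab : a < b) (hT : 0 < T)
    (hN : N₀.Finite) (hsub : N₀ ⊆ Icc a b) (hu : IsClassicalSol a b T N₀ u₀ u) {r : ℝ}
    (hr : 0 < r) (hrab : r < (b - a) / 2) :
    IntegrableOn (fun p => (pdx u p.1 p.2) ^ 2)
      ((Ioo a b ∩ Metric.ball ((a + b) / 2) ((b - a) / 2 - r)) ×ˢ Ioc 0 T) := by
  obtain ⟨M, hM⟩ := hu.exists_bound
  have hM0 : 0 ≤ M := (abs_nonneg _).trans
    (hM a (left_mem_Icc.2 hab.le) 0 (left_mem_Icc.2 hT.le))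
  let f : ContDiffBump ((a + b) / 2) :=
    ⟨(b - a) / 2 - r, (b - a) / 2 - r / 2, by linarith, by linarith⟩
  refine IntegrableOn.pdx_sq_of_bump f le_rfl ?_
  refine hu.integrableOn_pdx_sq_mul_sq hab hT hN f.contDiff f.abs_le_one
    (C := 2 * (M + 1) ^ 4) (c := 0) (m := 1) (by positivity) one_pos
    (fun δ => (isMultiplier_levelCutoff δ).sign_mul) (w := levelCutoff)
    (fun δ x hx t ht _ => energyBounds_sign_levelCutoff hM0
      (hM x (Ioo_subset_Icc_self hx) t (Ioc_subset_Icc_self ht))) ?_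
    continuous_levelCutoff (fun s hs => eventually_levelCutoff_eq_one hs)
  intro δ hδ z hz
  have hend : |z - (a + b) / 2| = (b - a) / 2 → ∀ᶠ x in 𝓝 z, f x = 0 := by
    intro h
    refine f.eventually_eq_zero ?_
    change (b - a) / 2 - r / 2 < |z - (a + b) / 2|
    linarith
  rcases hz with rfl | rfl | hz
  · left
    refine hend ?_
    rw [abs_of_nonpos (by linarith)]
    ring
  · left
    refine hend ?_
    rw [abs_of_nonneg (by linarith)]
    ring
  · right
    obtain ⟨ρ, hρ, hρu⟩ := hu.eventually_abs_sub_lt (hsub hz) hδ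
    filter_upwards [Metric.ball_mem_nhds z hρ] with x hx hxI t ht
    have hlt : |u x t| < δ := by
      have := hρu x hxI (by simpa [Real.dist_eq] using hx) t (Ioc_subset_Icc_self ht)
      rwa [(hu.zero_iff z (hsub hz) t (Ioc_subset_Icc_self ht)).2 hz, sub_zero] at this
    refine ⟨?_, ?_, ?_⟩
    · rw [primitive_eq_zero (fun q hq => levelCutoff_eq_zero hq) hlt, mul_zero]
    · rw [levelCutoff_eq_zero hlt, mul_zero]
    · rw [levelCutoffDeriv_eq_zero hlt, mul_zero]

theorem IsClassicalSol.integrableOn_pdx_sq (hab : a < b) (hT : 0 < T)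
    (hN : N₀.Finite) (hsub : N₀ ⊆ Icc a b) (hu : IsClassicalSol a b T N₀ u₀ u) :
    IntegrableOn (fun p => (pdx u p.1 p.2) ^ 2) (QT a b T) := by
  have hTm : T ∈ Ioc 0 T := ⟨hT, le_rfl⟩
  have ha := left_mem_Icc.2 hab.le
  have hb := right_mem_Icc.2 hab.le
  have h0 : ∀ z ∈ N₀, u z T = 0 := fun z hz =>
    (hu.zero_iff z (hsub hz) T (Ioc_subset_Icc_self hTm)).2 hz
  obtain ⟨r₁, hr₁, h₁⟩ := hu.exists_integrableOn_pdx_sq_near_endpoint hab hT hN ha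
    (c := -1) (by simp) hu.bdry_a (by
      rintro z (rfl | rfl | hz)
      · exact ⟨ha, Or.inl rfl⟩
      · exact ⟨hb, Or.inr (by rw [hu.bdry_b T hTm]; norm_num)⟩
      · exact ⟨hsub hz, Or.inr (by rw [h0 z hz, mul_zero])⟩)
  obtain ⟨r₂, hr₂, h₂⟩ := hu.exists_integrableOn_pdx_sq_near_endpoint hab hT hN hb
    (c := 1) (by simp) hu.bdry_b (by
      rintro z (rfl | rfl | hz)
      · exact ⟨ha, Or.inr (by rw [hu.bdry_a T hTm]; norm_num)⟩
      · exact ⟨hb, Or.inl rfl⟩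
      · exact ⟨hsub hz, Or.inr (by rw [h0 z hz, mul_zero])⟩)
  obtain ⟨r, hr, hrlt⟩ := exists_between (lt_min (lt_min hr₁ hr₂) (half_pos (sub_pos.2 hab)))
  obtain ⟨⟨hr1, hr2⟩, hr3⟩ := by simpa only [lt_min_iff] using hrlt
  have h₃ := hu.integrableOn_pdx_sq_interior hab hT hN hsub hr hr3
  simp only [Real.ball_eq_Ioo] at h₁ h₂ h₃
  refine ((h₁.union h₂).union h₃).mono_set ?_
  rintro ⟨x, t⟩ ⟨hx, ht⟩
  have hxab : a < x ∧ x < b := hx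
  by_cases hxa : x < a + r₁
  · exact Or.inl (Or.inl ⟨⟨hx, by linarith, hxa⟩, ht⟩)
  by_cases hxb : b - r₂ < x
  · exact Or.inl (Or.inr ⟨⟨hx, hxb, by linarith⟩, ht⟩)
  · exact Or.inr ⟨⟨hx, by linarith, by linarith⟩, ht⟩

end GradientSquare

section WeakFormulation

variable {a b T : ℝ} {N₀ : Set ℝ} {u₀ : ℝ → ℝ} {u : ℝ → ℝ → ℝ} {ψ ψx ψt : ℝ × ℝ → ℝ}

theorem abs_energyDensity_le {M B C s A e ex et σ K k h : ℝ}
    (hs : |s| ≤ M) (hσ : |σ| ≤ 1) (hk : |k| ≤ 1) (hh : |(|s| * h)| ≤ C) (hK : |K| ≤ M)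
    (he : |e| ≤ B) (hex : |ex| ≤ B) (het : |et| ≤ B) :
    |(σ * k + |s| * h) * A ^ 2 * e + |s| * k * A * ex - s * (1 - |s|) * k * e - K * et|
      ≤ (1 + C) * A ^ 2 * B + M * 1 * (1 + A ^ 2) * B + M * (1 + M) * 1 * B + M * B := by
  have hM : 0 ≤ M := (abs_nonneg _).trans hs
  have hB : 0 ≤ B := (abs_nonneg _).trans he
  have hC : 0 ≤ C := (abs_nonneg _).trans hh
  have hA : |A| ≤ 1 + A ^ 2 := by
    rw [← sq_abs A]
    nlinarith [sq_nonneg (|A| - 1)]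
  have h1 : |(σ * k + |s| * h)| ≤ 1 + C := by
    refine (abs_add_le _ _).trans (add_le_add ?_ hh)
    rw [abs_mul]
    exact mul_le_one₀ hσ (abs_nonneg _) hk
  have h2 : |(1 - |s|)| ≤ 1 + M := by
    rw [abs_le]
    constructor <;> linarith [abs_nonneg s]
  refine (abs_sub _ _).trans (add_le_add ((abs_sub _ _).trans (add_le_add
    ((abs_add_le _ _).trans (add_le_add ?_ ?_)) ?_)) ?_)
  · rw [abs_mul, abs_mul, abs_of_nonneg (sq_nonneg A)]
    gcongr
  · rw [abs_mul, abs_mul, abs_mul, abs_abs]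
    gcongr
  · rw [abs_mul, abs_mul, abs_mul]
    gcongr
  · rw [abs_mul]
    gcongr

theorem IsClassicalSol.tendsto_integral_energyDensity (hab : a < b) (hT : 0 < T)
    (hN : N₀.Finite) (hsub : N₀ ⊆ Icc a b) (hu : IsClassicalSol a b T N₀ u₀ u)
    {B : ℝ} (hB : ∀ p, |ψ p| ≤ B) (hBx : ∀ p, |ψx p| ≤ B) (hBt : ∀ p, |ψt p| ≤ B)
    (hi : ∀ n : ℕ, IntegrableOn
      (energyDensity (fun s => ∫ r in (0 : ℝ)..s, levelCutoff (1 / ((n : ℝ) + 1)) r)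
        (levelCutoff (1 / ((n : ℝ) + 1))) (levelCutoffDeriv (1 / ((n : ℝ) + 1))) u ψ ψx ψt)
      (Ioo a b ×ˢ Ioc (T / ((n : ℝ) + 2)) T)) :
    Tendsto (fun n : ℕ => ∫ p in Ioo a b ×ˢ Ioc (T / ((n : ℝ) + 2)) T,
      energyDensity (fun s => ∫ r in (0 : ℝ)..s, levelCutoff (1 / ((n : ℝ) + 1)) r)
        (levelCutoff (1 / ((n : ℝ) + 1))) (levelCutoffDeriv (1 / ((n : ℝ) + 1))) u ψ ψx ψt p)
      atTop (𝓝 (∫ p in QT a b T, energyDensity id (fun _ => 1) (fun _ => 0) u ψ ψx ψt p)) := by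
  obtain ⟨M, hM⟩ := hu.exists_bound
  obtain ⟨C, hC0, hC⟩ := exists_mul_levelCutoffDeriv_le
  have hms : ∀ n : ℕ, MeasurableSet (Ioo a b ×ˢ Ioc (T / ((n : ℝ) + 2)) T) := fun n =>
    measurableSet_Ioo.prod measurableSet_Ioc
  have hQ : MeasurableSet (QT a b T) := measurableSet_Ioo.prod measurableSet_Ioc
  have hfin : volume (QT a b T) < ⊤ := by
    rw [QT, Measure.volume_eq_prod, Measure.prod_prod, Real.volume_Ioo, Real.volume_Ioc]
    exact ENNReal.mul_lt_top ENNReal.ofReal_lt_top ENNReal.ofReal_lt_top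
  have hconst : ∀ c : ℝ, IntegrableOn (fun _ : ℝ × ℝ => c) (QT a b T) := fun c =>
    integrableOn_const hfin.ne
  have hsq := hu.integrableOn_pdx_sq hab hT hN hsub
  have hS : ∀ n : ℕ, QT a b T ∩ Ioo a b ×ˢ Ioc (T / ((n : ℝ) + 2)) T
      = Ioo a b ×ˢ Ioc (T / ((n : ℝ) + 2)) T := fun n =>
    inter_eq_right.2 (prod_mono le_rfl (Ioc_subset_Ioc_left (div_nat_add_two_mem hT n).1.le))
  have hK0 : ∀ δ s, |∫ r in (0 : ℝ)..s, levelCutoff δ r| ≤ |s| := abs_primitive_levelCutoff_le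
  have key := tendsto_integral_of_dominated_convergence (μ := volume.restrict (QT a b T))
    (F := fun n : ℕ => (Ioo a b ×ˢ Ioc (T / ((n : ℝ) + 2)) T).indicator
      (energyDensity (fun s => ∫ r in (0 : ℝ)..s, levelCutoff (1 / ((n : ℝ) + 1)) r)
        (levelCutoff (1 / ((n : ℝ) + 1))) (levelCutoffDeriv (1 / ((n : ℝ) + 1))) u ψ ψx ψt))
    (f := energyDensity id (fun _ => 1) (fun _ => 0) u ψ ψx ψt)
    (fun p => (1 + C) * (pdx u p.1 p.2) ^ 2 * B + M * 1 * (1 + (pdx u p.1 p.2) ^ 2) * B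
      + M * (1 + M) * 1 * B + M * B) (fun n => ?_) ?_ (fun n => ?_) ?_
  · refine key.congr fun n => ?_
    rw [setIntegral_indicator (hms n), hS n]
  · exact ((hi n).integrable_indicator (hms n)).aestronglyMeasurable.mono_measure
      Measure.restrict_le_self
  · exact ((((hsq.const_mul (1 + C)).mul_const B).add
      ((((hconst 1).add hsq).const_mul (M * 1)).mul_const B)).add (hconst _)).add (hconst _)
  · filter_upwards [ae_restrict_mem hQ] with p hp
    have hs := hM p.1 (Ioo_subset_Icc_self hp.1) p.2 (Ioc_subset_Icc_self hp.2)
    refine (norm_indicator_le_norm_self _ _).trans ?_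
    refine abs_energyDensity_le hs (Real.abs_sign_le_one _) (abs_levelCutoff_le_one _ _) ?_
      ((hK0 _ _).trans hs) (hB p) (hBx p) (hBt p)
    rw [abs_mul, abs_abs, ← abs_mul]
    exact hC _ _
  · filter_upwards [ae_restrict_QT_notMem hN] with p hp
    have hne := hu.ne_zero hp
    have hKt := tendsto_primitive_levelCutoff (fun n : ℕ => by positivity)
      tendsto_one_div_add_atTop_nhds_zero_nat (tendsto_const_nhds (x := u p.1 p.2))
    refine ((hKt.mul_const (ψt p)).const_sub
      ((Real.sign (u p.1 p.2) * 1 + |u p.1 p.2| * 0) * (pdx u p.1 p.2) ^ 2 * ψ p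
        + |u p.1 p.2| * 1 * pdx u p.1 p.2 * ψx p
        - u p.1 p.2 * (1 - |u p.1 p.2|) * 1 * ψ p)).congr' ?_
    filter_upwards [eventually_two_mul_sq_lt tendsto_one_div_add_atTop_nhds_zero_nat hne,
      (tendsto_div_nat_add_two T).eventually_lt_const hp.1.2.1] with n h1 h2
    rw [indicator_of_mem (show p ∈ Ioo a b ×ˢ Ioc (T / ((n : ℝ) + 2)) T from
      ⟨hp.1.1, h2, hp.1.2.2⟩), energyDensity, levelCutoff_eq_one (by positivity) h1,
      levelCutoffDeriv_eq_zero_of_lt (by positivity) h1]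

theorem IsClassicalSol.tendsto_initial_integral (hT : 0 < T)
    (hu : IsClassicalSol a b T N₀ u₀ u) (hψ : Continuous ψ)
    {B : ℝ} (hB : ∀ p, |ψ p| ≤ B) :
    Tendsto (fun n : ℕ => ∫ x in Ioo a b,
      (∫ r in (0 : ℝ)..u x (T / ((n : ℝ) + 2)), levelCutoff (1 / ((n : ℝ) + 1)) r) *
        ψ (x, T / ((n : ℝ) + 2))) atTop (𝓝 (∫ x in Ioo a b, u x 0 * ψ (x, 0))) := by
  obtain ⟨M, hM⟩ := hu.exists_bound
  have hε : ∀ n : ℕ, T / ((n : ℝ) + 2) ∈ Icc 0 T := fun n =>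
    ⟨(div_nat_add_two_mem hT n).1.le, (div_nat_add_two_mem hT n).2.le⟩
  refine tendsto_integral_of_dominated_convergence (fun _ => M * B) (fun n => ?_)
    (integrableOn_const (by simp)) (fun n => ?_) ?_
  · have h1 : ContinuousOn (fun x => u x (T / ((n : ℝ) + 2))) (Ioo a b) :=
      hu.cont.comp (f := fun x => (x, T / ((n : ℝ) + 2))) (by fun_prop)
        fun x hx => ⟨Ioo_subset_Icc_self hx, hε n⟩
    have h2 : Continuous fun s => ∫ r in (0 : ℝ)..s, levelCutoff (1 / ((n : ℝ) + 1)) r :=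
      continuous_iff_continuousAt.2 fun s =>
        ((continuous_levelCutoff _).hasDerivAt_primitive s).continuousAt
    have h3 : Continuous fun x => ψ (x, T / ((n : ℝ) + 2)) := by fun_prop
    exact ((h2.comp_continuousOn h1).mul h3.continuousOn).aestronglyMeasurable measurableSet_Ioo
  · filter_upwards [ae_restrict_mem measurableSet_Ioo] with x hx
    have h1 := hM x (Ioo_subset_Icc_self hx) _ (hε n)
    rw [Real.norm_eq_abs, abs_mul]
    exact mul_le_mul ((abs_primitive_levelCutoff_le _ _).trans h1) (hB _) (abs_nonneg _)
      ((abs_nonneg _).trans h1)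
  · filter_upwards [ae_restrict_mem measurableSet_Ioo] with x hx
    have hx' := Ioo_subset_Icc_self hx
    have ht := (tendsto_const_nhds (x := x)).prodMk_nhds (tendsto_div_nat_add_two T)
    have h1 : Tendsto (fun n : ℕ => u x (T / ((n : ℝ) + 2))) atTop (𝓝 (u x 0)) :=
      (hu.cont (x, 0) ⟨hx', left_mem_Icc.2 hT.le⟩).tendsto.comp
        (tendsto_nhdsWithin_iff.2 ⟨ht, Eventually.of_forall fun n => ⟨hx', hε n⟩⟩)
    exact (tendsto_primitive_levelCutoff (fun n : ℕ => by positivity)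
      tendsto_one_div_add_atTop_nhds_zero_nat h1).mul ((hψ.tendsto (x, 0)).comp ht)

theorem IsClassicalSol.weak_identity (hab : a < b) (hT : 0 < T)
    (hN : N₀.Finite) (hsub : N₀ ⊆ Icc a b) (hu : IsClassicalSol a b T N₀ u₀ u)
    (hψ : IsTestFun ψ ψx ψt)
    {B : ℝ} (hB : ∀ p, |ψ p| ≤ B) (hBx : ∀ p, |ψx p| ≤ B) (hBt : ∀ p, |ψt p| ≤ B)
    (ha : ∀ᶠ x in 𝓝 a, ∀ t, ψ (x, t) = 0) (hb : ∀ᶠ x in 𝓝 b, ∀ t, ψ (x, t) = 0)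
    (hψT : ∀ x, ψ (x, T) = 0) :
    ∫ p in QT a b T, energyDensity id (fun _ => 1) (fun _ => 0) u ψ ψx ψt p =
      ∫ x in Ioo a b, u x 0 * ψ (x, 0) := by
  have hid := fun n : ℕ => hu.energy_identity hab hN
    (isMultiplier_levelCutoff (1 / ((n : ℝ) + 1))) hψ (by
      rintro z (rfl | rfl | hz)
      · exact Or.inl ha
      · exact Or.inl hb
      · right
        obtain ⟨ρ, hρ, hρu⟩ := hu.eventually_abs_sub_lt (hsub hz)
          (show 0 < 1 / ((n : ℝ) + 1) by positivity)
        filter_upwards [Metric.ball_mem_nhds z hρ] with x hx hxI t ht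
        have hlt : |u x t| < 1 / ((n : ℝ) + 1) := by
          have := hρu x hxI (by simpa [Real.dist_eq] using hx) t (Ioc_subset_Icc_self ht)
          rwa [(hu.zero_iff z (hsub hz) t (Ioc_subset_Icc_self ht)).2 hz, sub_zero] at this
        exact ⟨primitive_eq_zero (fun q hq => levelCutoff_eq_zero hq) hlt,
          levelCutoff_eq_zero hlt, levelCutoffDeriv_eq_zero hlt⟩)
    (div_nat_add_two_mem hT n).1 (div_nat_add_two_mem hT n).2
  refine tendsto_nhds_unique
    (hu.tendsto_integral_energyDensity hab hT hN hsub hB hBx hBt fun n => (hid n).1)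
    ((hu.tendsto_initial_integral hT hψ.cont hB).congr fun n => ?_)
  rw [(hid n).2]
  simp only [hψT, mul_zero, sub_zero]

theorem ContDiff.isTestFun (hψ : ContDiff ℝ 1 ψ) :
    IsTestFun ψ (fun p => fderiv ℝ ψ p (1, 0)) (fun p => fderiv ℝ ψ p (0, 1)) where
  cont := hψ.continuous
  cont_x := (hψ.continuous_fderiv one_ne_zero).clm_apply continuous_const
  cont_t := (hψ.continuous_fderiv one_ne_zero).clm_apply continuous_const
  hasDerivAt_x x t := (hψ.differentiable one_ne_zero (x, t)).hasFDerivAt.comp_hasDerivAt x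
    ((hasDerivAt_id x).prodMk (hasDerivAt_const x t))
  hasDerivAt_t x t := (hψ.differentiable one_ne_zero (x, t)).hasFDerivAt.comp_hasDerivAt t
    ((hasDerivAt_const t x).prodMk (hasDerivAt_id t))

theorem HasCompactSupport.exists_abs_le_fderiv (hψ : ContDiff ℝ 1 ψ)
    (hc : HasCompactSupport ψ) : ∃ B, (∀ p, |ψ p| ≤ B) ∧ (∀ p, |fderiv ℝ ψ p (1, 0)| ≤ B) ∧
      ∀ p, |fderiv ℝ ψ p (0, 1)| ≤ B := by
  obtain ⟨B₁, h₁⟩ := hc.exists_bound_of_continuous hψ.continuous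
  obtain ⟨B₂, h₂⟩ := (hc.fderiv (𝕜 := ℝ)).exists_bound_of_continuous
    (hψ.continuous_fderiv one_ne_zero)
  have h3 : ∀ p (v : ℝ × ℝ), ‖v‖ ≤ 1 → |fderiv ℝ ψ p v| ≤ max B₁ B₂ := fun p v hv =>
    ((fderiv ℝ ψ p).unit_le_opNorm v hv).trans ((h₂ p).trans (le_max_right _ _))
  exact ⟨max B₁ B₂, fun p => (h₁ p).trans (le_max_left _ _), fun p => h3 p _ (by simp),
    fun p => h3 p _ (by simp)⟩

theorem HasCompactSupport.eventually_fst_eq_zero (hc : HasCompactSupport ψ) {y : ℝ}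
    (hy : ∀ t, (y, t) ∉ tsupport ψ) : ∀ᶠ x in 𝓝 y, ∀ t, ψ (x, t) = 0 := by
  have h : y ∉ Prod.fst '' tsupport ψ := by
    rintro ⟨⟨x, t⟩, h1, rfl⟩
    exact hy t h1
  filter_upwards [(hc.isCompact.image continuous_fst).isClosed.isOpen_compl.mem_nhds h]
    with x hx t
  by_contra h0
  exact hx ⟨(x, t), subset_tsupport ψ h0, rfl⟩

end WeakFormulation

/-- The classical solution of the limit problem (2.7) is also a weak solution:
it is bounded, `u_x ∈ L²(Q)`, the boundary values hold for a.e. `t`, and the weak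
formulation of Definition 2.1 holds for every test function `ψ ∈ C_c^{1,1}((a,b)×[0,T))`. -/
theorem stmt1 (a b T : ℝ) (hab : a < b) (hT : 0 < T)
    (N₀ : Set ℝ) (u₀ : ℝ → ℝ) (h₀ : InitData a b N₀ u₀)
    (u : ℝ → ℝ → ℝ) (hu : IsClassicalSol a b T N₀ u₀ u) :
    (∃ M : ℝ, ∀ x ∈ Set.Icc a b, ∀ t ∈ Set.Icc (0:ℝ) T, |u x t| ≤ M) ∧
    MeasureTheory.IntegrableOn (fun p : ℝ × ℝ => (pdx u p.1 p.2) ^ 2) (QT a b T) volume ∧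
    (∀ᵐ t ∂(volume.restrict (Set.Ioo (0:ℝ) T)), u a t = -1 ∧ u b t = 1) ∧
    ∀ ψ : ℝ × ℝ → ℝ, ContDiff ℝ 1 ψ → HasCompactSupport ψ →
      tsupport ψ ⊆ Set.Ioo a b ×ˢ Set.Iio T →
      (∫ x in a..b, u₀ x * ψ (x, 0)) +
        (∫ p in QT a b T,
          (u p.1 p.2 * deriv (fun s => ψ (p.1, s)) p.2
            - |u p.1 p.2| * pdx u p.1 p.2 * deriv (fun y => ψ (y, p.2)) p.1
            - (pdx u p.1 p.2) ^ 2 * Real.sign (u p.1 p.2) * ψ p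
            + u p.1 p.2 * (1 - |u p.1 p.2|) * ψ p)) = 0 := by
  have hsub : N₀ ⊆ Icc a b := h₀.sub.trans Ioo_subset_Icc_self
  refine ⟨hu.exists_bound, hu.integrableOn_pdx_sq hab hT h₀.fin hsub, ?_, ?_⟩
  · filter_upwards [ae_restrict_mem measurableSet_Ioo] with t ht
    exact ⟨hu.bdry_a t (Ioo_subset_Ioc_self ht), hu.bdry_b t (Ioo_subset_Ioc_self ht)⟩
  · intro ψ hψ hc hsupp
    obtain ⟨B, hB, hBx, hBt⟩ := hc.exists_abs_le_fderiv hψ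
    have htest := hψ.isTestFun
    have hw := hu.weak_identity hab hT h₀.fin hsub htest hB hBx hBt
      (hc.eventually_fst_eq_zero fun t h => lt_irrefl a (hsupp h).1.1)
      (hc.eventually_fst_eq_zero fun t h => lt_irrefl b (hsupp h).1.2)
      (fun x => image_eq_zero_of_notMem_tsupport fun h => lt_irrefl T (hsupp h).2)
    have hinit : ∫ x in a..b, u₀ x * ψ (x, 0) = ∫ x in Ioo a b, u x 0 * ψ (x, 0) := by
      rw [intervalIntegral.integral_of_le hab.le, integral_Ioc_eq_integral_Ioo]
      exact setIntegral_congr_fun measurableSet_Ioo fun x hx => by simp only [hu.init x hx]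
    rw [hinit, ← hw, add_comm, ← eq_neg_iff_add_eq_zero, ← integral_neg]
    refine integral_congr_ae (ae_of_all _ fun p => ?_)
    simp only [energyDensity, id, (htest.hasDerivAt_x p.1 p.2).deriv,
      (htest.hasDerivAt_t p.1 p.2).deriv]
    ring
end

section
/- Let u₀ satisfy (2.8) and let u be the unique classical solution of the limit problem (2.7). Then for every t₀ ∈ (0,T) the spatial derivative u_x is bounded on ((a,b) ∖ N₀) × (t₀,T); moreover, for every t ∈ (0,T] and every i = 1,…,k the one-sided limits u_x(x_i⁺, t) and u_x(x_i⁻, t) exist and are finite, so that x ↦ u_x(x,t) has at most a jump discontinuity at each x_i ∈ N₀. -/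
open Set Filter MeasureTheory Topology

/-- Second derivative test, necessary direction. -/
theorem second_deriv_nonneg_of_isLocalMin {f f₁ : ℝ → ℝ} {x d : ℝ}
    (h₁ : ∀ᶠ y in 𝓝 x, HasDerivAt f (f₁ y) y) (h₂ : HasDerivAt f₁ d x)
    (hm : IsLocalMin f x) : 0 ≤ d := by
  by_contra! hd
  have he : deriv f =ᶠ[𝓝 x] f₁ := h₁.mono fun y hy => hy.deriv
  have hdd : deriv (deriv f) x = d := by rw [he.deriv_eq, h₂.deriv]
  have hmax : IsLocalMax f x :=
    isLocalMax_of_deriv_deriv_neg (hdd ▸ hd) hm.deriv_eq_zero h₁.self_of_nhds.continuousAt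
  have hc : f =ᶠ[𝓝 x] fun _ => f x := by
    filter_upwards [hm, hmax] with y hy hy'
    exact le_antisymm hy' hy
  have h0 : deriv (deriv f) x = 0 := by
    rw [hc.deriv.deriv_eq]
    simp
  linarith

/-- A function that is minimal at the right end of an interval has nonpositive derivative there. -/
theorem hasDerivAt_nonpos_of_min_right {f : ℝ → ℝ} {s t d : ℝ} (hst : s < t)
    (hm : ∀ y ∈ Icc s t, f t ≤ f y) (hd : HasDerivAt f d t) : d ≤ 0 := by
  have h := (hasDerivWithinAt_iff_tendsto_slope' (s := Iio t) (by simp)).1 hd.hasDerivWithinAt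
  refine le_of_tendsto h ?_
  filter_upwards [Ioo_mem_nhdsLT hst] with y hy
  rw [slope_def_field]
  exact div_nonpos_of_nonneg_of_nonpos (by linarith [hm y ⟨hy.1.le, hy.2.le⟩]) (by linarith [hy.2])

/-- Parabolic minimum principle: a continuous function on a rectangle which is nonnegative on the
parabolic boundary, and which has no negative value at which both `0 ≤ F_xx` and `F_t ≤ 0`, is
nonnegative. -/
theorem parabolic_min_principle {α β s e : ℝ} {F : ℝ → ℝ → ℝ}
    (hF : ContinuousOn (Function.uncurry F) (Icc α β ×ˢ Icc s e))
    (hα : ∀ t ∈ Icc s e, 0 ≤ F α t) (hβ : ∀ t ∈ Icc s e, 0 ≤ F β t)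
    (hs : ∀ x ∈ Icc α β, 0 ≤ F x s)
    (hval : ∀ x ∈ Ioo α β, ∀ t ∈ Ioc s e, F x t < 0 → ∃ (F₁ : ℝ → ℝ) (d₂ d : ℝ),
      (∀ᶠ y in 𝓝 x, HasDerivAt (fun y => F y t) (F₁ y) y) ∧ HasDerivAt F₁ d₂ x ∧
        HasDerivAt (F x) d t ∧ (d₂ < 0 ∨ 0 < d)) :
    ∀ x ∈ Icc α β, ∀ t ∈ Icc s e, 0 ≤ F x t := by
  intro x hx t ht
  obtain ⟨⟨y, r⟩, ⟨hy, hr⟩, hmin⟩ :=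
    (isCompact_Icc.prod isCompact_Icc).exists_isMinOn ⟨(x, t), hx, ht⟩ hF
  have hmin' : ∀ z ∈ Icc α β, ∀ τ ∈ Icc s e, F y r ≤ F z τ := fun z hz τ hτ =>
    hmin (a := (z, τ)) ⟨hz, hτ⟩
  by_contra! hneg
  have hyr : F y r < 0 := (hmin' x hx t ht).trans_lt hneg
  simp only at hy hr
  have hy' : y ∈ Ioo α β := by
    refine ⟨lt_of_le_of_ne hy.1 ?_, lt_of_le_of_ne hy.2 ?_⟩
    · rintro rfl
      linarith [hα r hr]
    · rintro rfl
      linarith [hβ r hr]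
  have hr' : r ∈ Ioc s e := by
    refine ⟨lt_of_le_of_ne hr.1 ?_, hr.2⟩
    rintro rfl
    linarith [hs y hy]
  obtain ⟨F₁, d₂, d, h1, h2, h3, h4⟩ := hval y hy' r hr' hyr
  have hd₂ : 0 ≤ d₂ := by
    refine second_deriv_nonneg_of_isLocalMin h1 h2 ?_
    filter_upwards [Ioo_mem_nhds hy'.1 hy'.2] with z hz
    exact hmin' z ⟨hz.1.le, hz.2.le⟩ r hr
  have hd : d ≤ 0 := hasDerivAt_nonpos_of_min_right hr'.1
    (fun τ hτ => hmin' y hy τ ⟨hτ.1, hτ.2.trans hr.2⟩) h3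
  rcases h4 with h4 | h4 <;> linarith

/-- Differentiation under the integral sign over a compact interval. -/
theorem hasDerivAt_integral_of_continuousOn {α β c d x : ℝ} {f f' : ℝ → ℝ → ℝ} (hcd : c ≤ d)
    (hx : x ∈ Ioo α β) (hf : ∀ y ∈ Ioo α β, ContinuousOn (f y) (Icc c d))
    (hf' : ContinuousOn (Function.uncurry f') (Ioo α β ×ˢ Icc c d))
    (hd : ∀ y ∈ Ioo α β, ∀ t ∈ Icc c d, HasDerivAt (fun z => f z t) (f' y t) y) :
    HasDerivAt (fun y => ∫ t in c..d, f y t) (∫ t in c..d, f' x t) x := by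
  obtain ⟨δ, hδ, hball⟩ := Metric.nhds_basis_closedBall.mem_iff.1 (Ioo_mem_nhds hx.1 hx.2)
  have hsub : Metric.closedBall x δ ×ˢ Icc c d ⊆ Ioo α β ×ˢ Icc c d := prod_mono hball le_rfl
  obtain ⟨C, hC⟩ := ((isCompact_closedBall x δ).prod isCompact_Icc).exists_bound_of_continuousOn
    (hf'.mono hsub)
  have hIoc : uIoc c d = Ioc c d := uIoc_of_le hcd
  have hms : ∀ g : ℝ → ℝ, ContinuousOn g (Icc c d) →
      AEStronglyMeasurable g (volume.restrict (uIoc c d)) := fun g hg => by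
    rw [hIoc]
    exact (hg.mono Ioc_subset_Icc_self).aestronglyMeasurable measurableSet_Ioc
  refine (intervalIntegral.hasDerivAt_integral_of_dominated_loc_of_deriv_le
    (bound := fun _ => C) (F' := f') (Metric.closedBall_mem_nhds x hδ) ?_ ?_ ?_ ?_ ?_ ?_).2
  · filter_upwards [Ioo_mem_nhds hx.1 hx.2] with y hy
    exact hms _ (hf y hy)
  · exact ContinuousOn.intervalIntegrable (by rw [uIcc_of_le hcd]; exact hf x hx)
  · exact hms _ (hf'.comp (f := fun t => (x, t)) (by fun_prop) fun t ht => ⟨hx, ht⟩)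
  · refine Eventually.of_forall fun t ht y hy => ?_
    rw [hIoc] at ht
    exact hC (y, t) ⟨hy, Ioc_subset_Icc_self ht⟩
  · simp
  · refine Eventually.of_forall fun t ht y hy => ?_
    rw [hIoc] at ht
    exact hd y (hball hy) t (Ioc_subset_Icc_self ht)

/-- `u`, with spatial derivatives `p = u_x` and `q = u_xx`, is a positive solution of
`u_t = u u_xx + u (1 - u)` on the strip `(α, β) × (0, T)`, with lateral boundary values `0` or
`1`. -/
structure PositiveStrip (α β T : ℝ) (u p q : ℝ → ℝ → ℝ) : Prop where
  lt : α < β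
  cont : Continuous (Function.uncurry u)
  pos : ∀ x ∈ Ioo α β, ∀ t ∈ Icc 0 T, 0 < u x t
  hasDerivAt_x : ∀ x ∈ Ioo α β, ∀ t ∈ Ioc 0 T, HasDerivAt (fun y => u y t) (p x t) x
  hasDerivAt_xx : ∀ x ∈ Ioo α β, ∀ t ∈ Ioc 0 T, HasDerivAt (fun y => p y t) (q x t) x
  hasDerivAt_t : ∀ x ∈ Ioo α β, ∀ t ∈ Ioo 0 T,
    HasDerivAt (u x) (u x t * (q x t + 1 - u x t)) t
  cont_x : ContinuousOn (Function.uncurry p) (Ioo α β ×ˢ Ioc 0 T)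
  cont_xx : ContinuousOn (Function.uncurry q) (Ioo α β ×ˢ Ioc 0 T)
  left : ∃ c : ℝ, (c = 0 ∨ c = 1) ∧ ∀ t ∈ Ioc 0 T, u α t = c
  right : ∃ c : ℝ, (c = 0 ∨ c = 1) ∧ ∀ t ∈ Ioc 0 T, u β t = c

namespace PositiveStrip

variable {α β T : ℝ} {u p q : ℝ → ℝ → ℝ}

theorem reflect (S : PositiveStrip α β T u p q) :
    PositiveStrip (-β) (-α) T (fun x => u (-x)) (fun x t => -p (-x) t) (fun x => q (-x)) := by
  have hm : ∀ {x : ℝ}, x ∈ Ioo (-β) (-α) → -x ∈ Ioo α β := fun {x} hx =>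
    ⟨by linarith [hx.2], by linarith [hx.1]⟩
  have hmaps : MapsTo (fun z : ℝ × ℝ => (-z.1, z.2)) (Ioo (-β) (-α) ×ˢ Ioc 0 T)
      (Ioo α β ×ˢ Ioc 0 T) := fun z hz => ⟨hm hz.1, hz.2⟩
  refine ⟨by linarith [S.lt], S.cont.comp (f := fun z : ℝ × ℝ => (-z.1, z.2)) (by fun_prop),
    fun x hx t ht => S.pos _ (hm hx) t ht, fun x hx t ht => ?_, fun x hx t ht => ?_,
    fun x hx t ht => S.hasDerivAt_t _ (hm hx) t ht, ?_, ?_, ?_, ?_⟩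
  · exact ((S.hasDerivAt_x _ (hm hx) t ht).comp x (hasDerivAt_neg x)).congr_deriv (by simp)
  · exact ((S.hasDerivAt_xx _ (hm hx) t ht).comp x (hasDerivAt_neg x)).neg.congr_deriv (by simp)
  · exact (S.cont_x.comp (by fun_prop) hmaps).neg
  · exact S.cont_xx.comp (by fun_prop) hmaps
  · simpa using S.right
  · simpa using S.left

theorem hasDerivAt_timeIntegral (S : PositiveStrip α β T u p q) (x t₁ τ : ℝ) :
    HasDerivAt (fun r => ∫ s in t₁..t₁ + r, u x s) (u x (t₁ + τ)) τ := by
  have h := ((S.cont.uncurry_left x).integral_hasStrictDerivAt t₁ (t₁ + τ)).hasDerivAt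
  exact (HasDerivAt.comp_const_add t₁ τ h :)

theorem hasDerivAt_timeIntegral_x (S : PositiveStrip α β T u p q) {x t₁ τ : ℝ}
    (hx : x ∈ Ioo α β) (ht₁ : 0 < t₁) (hτ : 0 ≤ τ) (hτT : t₁ + τ ≤ T) :
    HasDerivAt (fun y => ∫ s in t₁..t₁ + τ, u y s) (∫ s in t₁..t₁ + τ, p x s) x := by
  have hsub : Icc t₁ (t₁ + τ) ⊆ Ioc 0 T := fun s hs => ⟨ht₁.trans_le hs.1, hs.2.trans hτT⟩
  exact hasDerivAt_integral_of_continuousOn (by linarith) hx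
    (fun y _ => (S.cont.uncurry_left y).continuousOn)
    (S.cont_x.mono (prod_mono le_rfl hsub)) fun y hy s hs => S.hasDerivAt_x y hy s (hsub hs)

theorem hasDerivAt_timeIntegral_xx (S : PositiveStrip α β T u p q) {x t₁ τ : ℝ}
    (hx : x ∈ Ioo α β) (ht₁ : 0 < t₁) (hτ : 0 ≤ τ) (hτT : t₁ + τ ≤ T) :
    HasDerivAt (fun y => ∫ s in t₁..t₁ + τ, p y s) (∫ s in t₁..t₁ + τ, q x s) x := by
  have hsub : Icc t₁ (t₁ + τ) ⊆ Ioc 0 T := fun s hs => ⟨ht₁.trans_le hs.1, hs.2.trans hτT⟩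
  exact hasDerivAt_integral_of_continuousOn (by linarith) hx
    (fun y hy => S.cont_x.comp (f := fun s => (y, s)) (by fun_prop) fun s hs => ⟨hy, hsub hs⟩)
    (S.cont_xx.mono (prod_mono le_rfl hsub)) fun y hy s hs => S.hasDerivAt_xx y hy s (hsub hs)

/-- The equation integrated in time after division by `u`. -/
theorem log_eq (S : PositiveStrip α β T u p q) {x t₁ τ : ℝ}
    (hx : x ∈ Ioo α β) (ht₁ : 0 < t₁) (hτ : 0 ≤ τ) (hτT : t₁ + τ ≤ T) :
    Real.log (u x (t₁ + τ)) = Real.log (u x t₁) + (∫ s in t₁..t₁ + τ, q x s) + τ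
      - ∫ s in t₁..t₁ + τ, u x s := by
  have hle : t₁ ≤ t₁ + τ := by linarith
  have hsub : Icc t₁ (t₁ + τ) ⊆ Ioc 0 T := fun s hs => ⟨ht₁.trans_le hs.1, hs.2.trans hτT⟩
  have hu : Continuous (u x) := S.cont.uncurry_left x
  have hpos : ∀ s ∈ Icc t₁ (t₁ + τ), 0 < u x s := fun s hs =>
    S.pos x hx s (Ioc_subset_Icc_self (hsub hs))
  have hq : ContinuousOn (q x) (Icc t₁ (t₁ + τ)) :=
    S.cont_xx.comp (f := fun s => (x, s)) (by fun_prop) fun s hs => ⟨hx, hsub hs⟩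
  have hqi : IntervalIntegrable (q x) volume t₁ (t₁ + τ) :=
    ContinuousOn.intervalIntegrable (by rwa [uIcc_of_le hle])
  have hui : IntervalIntegrable (u x) volume t₁ (t₁ + τ) := hu.intervalIntegrable _ _
  have h1i : IntervalIntegrable (fun _ : ℝ => (1 : ℝ)) volume t₁ (t₁ + τ) := by simp
  have key := intervalIntegral.integral_eq_sub_of_hasDerivAt_of_le (f := fun s => Real.log (u x s))
    (f' := fun s => q x s + 1 - u x s) hle
    (hu.continuousOn.log fun s hs => (hpos s hs).ne') (fun s hs => by
      have hs' := hpos s (Ioo_subset_Icc_self hs)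
      refine ((S.hasDerivAt_t x hx s ⟨ht₁.trans hs.1, hs.2.trans_le hτT⟩).log hs'.ne').congr_deriv
        ?_
      field_simp) ((hqi.add h1i).sub hui)
  rw [intervalIntegral.integral_sub (hqi.add h1i) hui, intervalIntegral.integral_add hqi h1i] at key
  simp at key
  linarith

/-- Along the dilations `τ ↦ l τ`, `τ ↦ τ / l`, the time integral of `u` satisfies a midpoint
convexity inequality. -/
theorem timeIntegral_convex (S : PositiveStrip α β T u p q) {t₁ l e : ℝ} (ht₁ : 0 < t₁)
    (hl : 0 < l) (he : 0 < e) (heT : t₁ + e ≤ T) (hleT : t₁ + l * e ≤ T) (hdeT : t₁ + e / l ≤ T)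
    {x : ℝ} (hx : x ∈ Icc α β) :
    0 ≤ (∫ s in t₁..t₁ + l * e, u x s) + (∫ s in t₁..t₁ + e / l, u x s)
      - 2 * ∫ s in t₁..t₁ + e, u x s := by
  have hamgm : 0 ≤ l + 1 / l - 2 := by
    have : l + 1 / l - 2 = (l - 1) ^ 2 / l := by
      field_simp
      ring
    rw [this]
    positivity
  have hdom : ∀ τ ∈ Icc 0 e, 0 ≤ τ ∧ 0 ≤ l * τ ∧ 0 ≤ τ / l ∧ t₁ + τ ≤ T ∧ t₁ + l * τ ≤ T ∧
      t₁ + τ / l ≤ T := fun τ hτ => by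
    have h0 := hτ.1
    refine ⟨h0, by positivity, by positivity, by linarith [hτ.2], ?_, ?_⟩
    · nlinarith [hτ.2]
    · have : τ / l ≤ e / l := by gcongr; exact hτ.2
      linarith
  have hbdry : ∀ z : ℝ, (∃ c : ℝ, (c = 0 ∨ c = 1) ∧ ∀ t ∈ Ioc 0 T, u z t = c) → ∀ τ ∈ Icc 0 e,
      0 ≤ (∫ s in t₁..t₁ + l * τ, u z s) + (∫ s in t₁..t₁ + τ / l, u z s)
        - 2 * ∫ s in t₁..t₁ + τ, u z s := by
    rintro z ⟨c, hc, hz⟩ τ hτ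
    have hval : ∀ r, 0 ≤ r → t₁ + r ≤ T → ∫ s in t₁..t₁ + r, u z s = c * r := fun r hr hrT => by
      rw [intervalIntegral.integral_congr (g := fun _ => c)]
      · simp [mul_comm]
      · intro s hs
        rw [uIcc_of_le (by linarith)] at hs
        exact hz s ⟨ht₁.trans_le hs.1, hs.2.trans hrT⟩
    obtain ⟨h1, h2, h3, h4, h5, h6⟩ := hdom τ hτ
    rw [hval _ h1 h4, hval _ h2 h5, hval _ h3 h6]
    have hc0 : 0 ≤ c := by rcases hc with rfl | rfl <;> norm_num
    have : c * (l * τ) + c * (τ / l) - 2 * (c * τ) = c * τ * (l + 1 / l - 2) := by ring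
    rw [this]
    positivity
  have hcont : Continuous fun z : ℝ × ℝ => ∫ s in t₁..t₁ + z.2, u z.1 s :=
    intervalIntegral.continuous_parametric_intervalIntegral_of_continuous
      (f := fun (z : ℝ × ℝ) s => u z.1 s)
      (S.cont.comp (f := fun z : (ℝ × ℝ) × ℝ => (z.1.1, z.2)) (by fun_prop)) (by fun_prop)
  refine parabolic_min_principle (α := α) (β := β) (s := 0) (e := e)
    (F := fun y τ => (∫ s in t₁..t₁ + l * τ, u y s) + (∫ s in t₁..t₁ + τ / l, u y s)
      - 2 * ∫ s in t₁..t₁ + τ, u y s) ?_ (hbdry α S.left) (hbdry β S.right) (by simp) ?_ x hx e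
    (right_mem_Icc.2 he.le)
  · have h1 := hcont.comp (f := fun z : ℝ × ℝ => (z.1, l * z.2)) (by fun_prop)
    have h2 := hcont.comp (f := fun z : ℝ × ℝ => (z.1, z.2 / l)) (by fun_prop)
    exact ((h1.add h2).sub (continuous_const.mul hcont)).continuousOn
  · intro y hy τ hτ hneg
    obtain ⟨h1, h2, h3, h4, h5, h6⟩ := hdom τ (Ioc_subset_Icc_self hτ)
    refine ⟨fun z => (∫ s in t₁..t₁ + l * τ, p z s) + (∫ s in t₁..t₁ + τ / l, p z s)
      - 2 * ∫ s in t₁..t₁ + τ, p z s, (∫ s in t₁..t₁ + l * τ, q y s) +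
      (∫ s in t₁..t₁ + τ / l, q y s) - 2 * ∫ s in t₁..t₁ + τ, q y s,
      l * u y (t₁ + l * τ) + u y (t₁ + τ / l) / l - 2 * u y (t₁ + τ), ?_, ?_, ?_, ?_⟩
    · filter_upwards [Ioo_mem_nhds hy.1 hy.2] with z hz
      exact ((S.hasDerivAt_timeIntegral_x hz ht₁ h2 h5).add
        (S.hasDerivAt_timeIntegral_x hz ht₁ h3 h6)).sub
        ((S.hasDerivAt_timeIntegral_x hz ht₁ h1 h4).const_mul 2)
    · exact ((S.hasDerivAt_timeIntegral_xx hy ht₁ h2 h5).add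
        (S.hasDerivAt_timeIntegral_xx hy ht₁ h3 h6)).sub
        ((S.hasDerivAt_timeIntegral_xx hy ht₁ h1 h4).const_mul 2)
    · have d1 := (S.hasDerivAt_timeIntegral y t₁ (l * τ)).comp τ ((hasDerivAt_id τ).const_mul l)
      have d2 := (S.hasDerivAt_timeIntegral y t₁ (τ / l)).comp τ ((hasDerivAt_id τ).div_const l)
      exact ((d1.add d2).sub ((S.hasDerivAt_timeIntegral y t₁ τ).const_mul 2)).congr_deriv
        (by ring)
    · by_contra! hcon
      obtain ⟨hxx, ht⟩ := hcon
      have g1 := S.log_eq hy ht₁ h2 h5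
      have g2 := S.log_eq hy ht₁ h3 h6
      have g3 := S.log_eq hy ht₁ h1 h4
      have hpos : ∀ r, 0 ≤ r → t₁ + r ≤ T → 0 < u y (t₁ + r) := fun r hr hrT =>
        S.pos y hy _ ⟨by linarith, hrT⟩
      have p1 := hpos _ h2 h5
      have p2 := hpos _ h3 h6
      have p3 := hpos _ h1 h4
      have hle : u y (t₁ + l * τ) * u y (t₁ + τ / l) ≤ u y (t₁ + τ) ^ 2 := by
        have : u y (t₁ + l * τ) * u y (t₁ + τ / l)
            = (l * u y (t₁ + l * τ)) * (u y (t₁ + τ / l) / l) := by field_simp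
        rw [this]
        have a1 : 0 < l * u y (t₁ + l * τ) := by positivity
        have a2 : 0 < u y (t₁ + τ / l) / l := by positivity
        nlinarith [sq_nonneg (l * u y (t₁ + l * τ) - u y (t₁ + τ / l) / l)]
      have hlog := Real.log_le_log (mul_pos p1 p2) hle
      rw [Real.log_mul p1.ne' p2.ne', Real.log_pow] at hlog
      push_cast at hlog
      have hτ' : l * τ + τ / l - 2 * τ = τ * (l + 1 / l - 2) := by ring
      have : 0 ≤ τ * (l + 1 / l - 2) := mul_nonneg h1 hamgm
      linarith

/-- An Aronson–Bénilan estimate: `(t - t₁) u` is nondecreasing in time. -/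
theorem aronson_benilan (S : PositiveStrip α β T u p q) {x t₁ t : ℝ} (hx : x ∈ Ioo α β)
    (ht₁ : 0 < t₁) (ht : t₁ < t) (htT : t < T) :
    0 ≤ u x t + (t - t₁) * (u x t * (q x t + 1 - u x t)) := by
  obtain ⟨τ, hτ⟩ : ∃ τ, τ = t - t₁ := ⟨_, rfl⟩
  have hτ0 : 0 < τ := by linarith
  have htτ : t = t₁ + τ := by linarith
  have hder : ∀ l : ℝ, 0 < l → HasDerivAt (fun l => (∫ s in t₁..t₁ + l * τ, u x s) +
      (∫ s in t₁..t₁ + τ / l, u x s) - 2 * ∫ s in t₁..t₁ + τ, u x s)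
      (u x (t₁ + l * τ) * τ - u x (t₁ + τ / l) * (τ / l ^ 2)) l := fun l hl => by
    have d1 := (S.hasDerivAt_timeIntegral x t₁ (l * τ)).comp l ((hasDerivAt_id l).mul_const τ)
    have d2 := (S.hasDerivAt_timeIntegral x t₁ (τ / l)).comp l
      ((hasDerivAt_const l τ).div (hasDerivAt_id l) hl.ne')
    refine ((d1.add d2).sub_const _).congr_deriv ?_
    simp
    ring
  have hder2 : HasDerivAt (fun l => u x (t₁ + l * τ) * τ - u x (t₁ + τ / l) * (τ / l ^ 2))
      (2 * τ * (u x t + (t - t₁) * (u x t * (q x t + 1 - u x t)))) 1 := by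
    have hu := S.hasDerivAt_t x hx t ⟨by linarith, htT⟩
    have d1 : HasDerivAt (fun l : ℝ => t₁ + l * τ) τ 1 := by
      simpa using ((hasDerivAt_id (1 : ℝ)).mul_const τ).const_add t₁
    have d2 : HasDerivAt (fun l : ℝ => t₁ + τ / l) (-τ) 1 := by
      simpa using ((hasDerivAt_const (1 : ℝ) τ).div (hasDerivAt_id 1) one_ne_zero).const_add t₁
    have d3 : HasDerivAt (fun l : ℝ => τ / l ^ 2) (-(2 * τ)) 1 := by
      have := (hasDerivAt_const (1 : ℝ) τ).div (hasDerivAt_pow 2 (1 : ℝ)) (by norm_num)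
      refine this.congr_deriv ?_
      norm_num
      ring
    have e1 : HasDerivAt (u x) (u x t * (q x t + 1 - u x t)) (t₁ + 1 * τ) := by
      rwa [one_mul, ← htτ]
    have e2 : HasDerivAt (u x) (u x t * (q x t + 1 - u x t)) (t₁ + τ / 1) := by
      rwa [div_one, ← htτ]
    have f1 := (e1.comp 1 d1).mul_const τ
    have f2 := (e2.comp 1 d2).mul d3
    refine (f1.sub f2).congr_deriv ?_
    simp only [Function.comp, div_one, one_pow, ← htτ]
    rw [← hτ]
    ring
  have h1 : ∀ᶠ l : ℝ in 𝓝 1, 0 < l := lt_mem_nhds one_pos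
  have hmin : IsLocalMin (fun l => (∫ s in t₁..t₁ + l * τ, u x s) +
      (∫ s in t₁..t₁ + τ / l, u x s) - 2 * ∫ s in t₁..t₁ + τ, u x s) 1 := by
    have c1 : ContinuousAt (fun l : ℝ => t₁ + l * τ) 1 := by fun_prop
    have c2 : ContinuousAt (fun l : ℝ => t₁ + τ / l) 1 := by
      fun_prop (disch := norm_num)
    have n1 : ∀ᶠ l : ℝ in 𝓝 1, t₁ + l * τ < T := c1.eventually_lt_const (by linarith)
    have n2 : ∀ᶠ l : ℝ in 𝓝 1, t₁ + τ / l < T := c2.eventually_lt_const (by linarith)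
    filter_upwards [h1, n1, n2] with l hl hl1 hl2
    have := S.timeIntegral_convex ht₁ hl hτ0 (by linarith) hl1.le hl2.le (Ioo_subset_Icc_self hx)
    simp only [one_mul, div_one]
    linarith
  have := second_deriv_nonneg_of_isLocalMin (h1.mono hder) hder2 hmin
  exact nonneg_of_mul_nonneg_right this (by positivity)

theorem xx_lower_bound (S : PositiveStrip α β T u p q) {x t₀ t : ℝ} (hx : x ∈ Ioo α β)
    (ht₀ : 0 < t₀) (ht : t ∈ Ioc t₀ T) : -(1 + 2 / t₀) ≤ q x t := by
  have hopen : ∀ r ∈ Ioo t₀ T, -(1 + 2 / t₀) ≤ q x r := fun r hr => by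
    have hu := S.pos x hx r ⟨(ht₀.trans hr.1).le, hr.2.le⟩
    have h := S.aronson_benilan (t₁ := t₀ / 2) hx (by linarith) (by linarith [hr.1]) hr.2
    have h' : 0 ≤ 1 + (r - t₀ / 2) * (q x r + 1 - u x r) := by
      have : 0 ≤ u x r * (1 + (r - t₀ / 2) * (q x r + 1 - u x r)) := by linarith
      exact nonneg_of_mul_nonneg_right this hu
    by_contra! hq
    have h1 : q x r + 1 - u x r < -(2 / t₀) := by linarith
    have h2 : (r - t₀ / 2) * (q x r + 1 - u x r) < (r - t₀ / 2) * -(2 / t₀) :=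
      mul_lt_mul_of_pos_left h1 (by linarith [hr.1])
    have h3 : (t₀ / 2) * (2 / t₀) ≤ (r - t₀ / 2) * (2 / t₀) :=
      mul_le_mul_of_nonneg_right (by linarith [hr.1]) (by positivity)
    have h4 : (t₀ / 2) * (2 / t₀) = 1 := by field_simp
    linarith
  rcases lt_or_eq_of_le ht.2 with h | rfl
  · exact hopen t ⟨ht.1, h⟩
  · have hc : ContinuousOn (q x) (Ioc 0 t) :=
      S.cont_xx.comp (f := fun s => (x, s)) (by fun_prop) fun s hs => ⟨hx, hs⟩
    have hlim : Tendsto (q x) (𝓝[<] t) (𝓝 (q x t)) := by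
      refine (hc t ⟨ht₀.trans ht.1, le_rfl⟩).mono_left ?_
      exact nhdsWithin_le_of_mem (mem_of_superset (Ioo_mem_nhdsLT (ht₀.trans ht.1))
        Ioo_subset_Ioc_self)
    refine ge_of_tendsto hlim ?_
    filter_upwards [Ioo_mem_nhdsLT ht.1] with r hr using hopen r hr

theorem monotoneOn_x_add (S : PositiveStrip α β T u p q) {t₀ t : ℝ} (ht₀ : 0 < t₀)
    (ht : t ∈ Ioc t₀ T) : MonotoneOn (fun x => p x t + (1 + 2 / t₀) * x) (Ioo α β) := by
  have hd : ∀ x ∈ Ioo α β,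
      HasDerivAt (fun x => p x t + (1 + 2 / t₀) * x) (q x t + (1 + 2 / t₀)) x := fun x hx => by
    exact ((S.hasDerivAt_xx x hx t ⟨ht₀.trans ht.1, ht.2⟩).add
      ((hasDerivAt_id x).const_mul (1 + 2 / t₀))).congr_deriv (by ring)
  refine monotoneOn_of_deriv_nonneg (convex_Ioo α β)
    (fun x hx => (hd x hx).continuousAt.continuousWithinAt)
    (fun x hx => (hd x (interior_subset hx)).differentiableAt.differentiableWithinAt)
    fun x hx => ?_
  rw [(hd x (interior_subset hx)).deriv]
  linarith [S.xx_lower_bound (interior_subset hx) ht₀ ht]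

/-- A linear lower bound for `u` at the left end of the strip bounds `u_x` from below. -/
theorem x_lower_bound (S : PositiveStrip α β T u p q) {A t₀ t x : ℝ} (ht₀ : 0 < t₀)
    (ht : t ∈ Ioc t₀ T) (hx : x ∈ Ioo α β) (hA : u α t - A * (x - α) ≤ u x t) :
    -A - (1 + 2 / t₀) * (β - α) ≤ p x t := by
  obtain ⟨ξ, hξ, hp⟩ := exists_hasDerivAt_eq_slope (fun y => u y t) (fun y => p y t) hx.1
    (S.cont.uncurry_right t).continuousOn
    fun y hy => S.hasDerivAt_x y ⟨hy.1, hy.2.trans hx.2⟩ t ⟨ht₀.trans ht.1, ht.2⟩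
  have h1 : -A ≤ p ξ t := by
    rw [hp, le_div_iff₀ (by linarith [hx.1])]
    linarith
  have h2 := S.monotoneOn_x_add ht₀ ht ⟨hξ.1, hξ.2.trans hx.2⟩ hx hξ.2.le
  simp only at h2
  have hC : 0 < 1 + 2 / t₀ := by positivity
  have h3 : (1 + 2 / t₀) * (x - ξ) ≤ (1 + 2 / t₀) * (β - α) :=
    mul_le_mul_of_nonneg_left (by linarith [hξ.1, hx.2]) hC.le
  linarith

theorem exists_tendsto_x_left (S : PositiveStrip α β T u p q) {t : ℝ} (ht : t ∈ Ioc 0 T)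
    (h0 : u α t = 0) : ∃ L : ℝ, Tendsto (fun x => p x t) (𝓝[>] α) (𝓝 L) := by
  have ht' : t ∈ Ioc (t / 2) T := ⟨by linarith [ht.1], ht.2⟩
  have ht₀ : 0 < t / 2 := by linarith [ht.1]
  have hC : 0 < 1 + 2 / (t / 2) := by positivity
  have hbdd : BddBelow ((fun x => p x t + (1 + 2 / (t / 2)) * x) '' Ioo α β) := by
    refine ⟨-0 - (1 + 2 / (t / 2)) * (β - α) + (1 + 2 / (t / 2)) * α, ?_⟩
    rintro _ ⟨x, hx, rfl⟩
    have := S.x_lower_bound (A := 0) ht₀ ht' hx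
      (by linarith [S.pos x hx t (Ioc_subset_Icc_self ht)])
    have := mul_le_mul_of_nonneg_left hx.1.le hC.le
    simp only
    linarith
  have hlim := (S.monotoneOn_x_add ht₀ ht').tendsto_nhdsWithin_Ioo_right
    (nonempty_Ioo.2 S.lt) hbdd
  have hlin : Tendsto (fun x : ℝ => (1 + 2 / (t / 2)) * x) (𝓝[>] α)
      (𝓝 ((1 + 2 / (t / 2)) * α)) :=
    (Continuous.tendsto (by fun_prop) α).mono_left nhdsWithin_le_nhds
  exact ⟨_, by simpa using hlim.sub hlin⟩

/-- A linear lower barrier at the left end of the strip. -/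
theorem exists_left_barrier (S : PositiveStrip α β T u p q) {t₀ : ℝ} (ht₀ : t₀ ∈ Ioo 0 T) :
    ∃ A : ℝ, ∀ t ∈ Ioo t₀ T, ∀ x ∈ Ioo α β, u α t - A * (x - α) ≤ u x t := by
  obtain ⟨h0, h0T⟩ := ht₀
  obtain ⟨c, rfl | rfl, hc⟩ := S.left
  · refine ⟨0, fun t ht x hx => ?_⟩
    have ht' : t ∈ Ioc 0 T := ⟨h0.trans ht.1, ht.2.le⟩
    linarith [hc t ht', S.pos x hx t (Ioc_subset_Icc_self ht')]
  have hαβ := S.lt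
  obtain ⟨ℓ, hℓ⟩ : ∃ ℓ, ℓ = (β - α) / 2 := ⟨_, rfl⟩
  have hℓ0 : 0 < ℓ := by linarith
  have hdom : Icc (t₀ / 2) T ⊆ Ioc 0 T := fun s hs => ⟨by linarith [hs.1], hs.2⟩
  have hpos : ∀ z ∈ Icc α (α + ℓ), ∀ s ∈ Icc (t₀ / 2) T, 0 < u z s := fun z hz s hs => by
    rcases eq_or_lt_of_le hz.1 with rfl | h
    · rw [hc s (hdom hs)]
      exact one_pos
    · exact S.pos z ⟨h, by linarith [hz.2]⟩ s (Ioc_subset_Icc_self (hdom hs))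
  obtain ⟨m, hm0, hm⟩ : ∃ m, 0 < m ∧ ∀ z ∈ Icc α (α + ℓ), ∀ s ∈ Icc (t₀ / 2) T, m ≤ u z s := by
    obtain ⟨⟨z₀, s₀⟩, ⟨hz₀, hs₀⟩, hmin⟩ :=
      (isCompact_Icc.prod isCompact_Icc).exists_isMinOn (s := Icc α (α + ℓ) ×ˢ Icc (t₀ / 2) T)
        ⟨(α, T), ⟨le_rfl, by linarith⟩, ⟨by linarith, le_rfl⟩⟩ S.cont.continuousOn
    exact ⟨u z₀ s₀, hpos z₀ hz₀ s₀ hs₀, fun z hz s hs => hmin (a := (z, s)) ⟨hz, hs⟩⟩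
  obtain ⟨D, hD⟩ : ∃ D, D = 2 / t₀ := ⟨_, rfl⟩
  obtain ⟨B, hB⟩ : ∃ B, B = D / m := ⟨_, rfl⟩
  obtain ⟨A, hA⟩ : ∃ A, A = 1 / ℓ + B * ℓ := ⟨_, rfl⟩
  have hD0 : 0 < D := by rw [hD]; positivity
  have hB0 : 0 < B := by rw [hB]; positivity
  have hmB : m * B = D := by rw [hB]; field_simp
  have hDt : D * (t₀ / 2) = 1 := by rw [hD]; field_simp
  have hAℓ : A * ℓ = 1 + B * ℓ * ℓ := by rw [hA]; field_simp
  have hquad : ∀ y ∈ Icc 0 ℓ, -A * y + B * y ^ 2 ≤ 0 := fun y hy => by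
    have h1 : B * y ≤ A := by
      rw [hA]
      have : B * y ≤ B * ℓ := mul_le_mul_of_nonneg_left hy.2 hB0.le
      have : 0 < 1 / ℓ := by positivity
      linarith
    nlinarith [mul_le_mul_of_nonneg_right h1 hy.1]
  refine ⟨A, fun t ht x hx => ?_⟩
  have hαt : u α t = 1 := hc t ⟨h0.trans ht.1, ht.2.le⟩
  have hsT : ∀ s ∈ Icc (t₀ / 2) t, s ∈ Icc (t₀ / 2) T := fun s hs => ⟨hs.1, hs.2.trans ht.2.le⟩
  rcases le_or_gt x (α + ℓ) with hxℓ | hxℓ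
  · have key := parabolic_min_principle (α := α) (β := α + ℓ) (s := t₀ / 2) (e := t)
      (F := fun y s => u y s - (1 - A * (y - α) + B * (y - α) ^ 2 - D * (t - s)))
      ?_ ?_ ?_ ?_ ?_ x ⟨hx.1.le, hxℓ⟩ t ⟨by linarith [ht.1], le_rfl⟩
    · simp only [sub_self, mul_zero, sub_zero] at key
      have : 0 ≤ B * (x - α) ^ 2 := by positivity
      linarith
    · exact (S.cont.sub (by simp only [Function.uncurry_def]; fun_prop :
        Continuous (Function.uncurry fun y s : ℝ =>
          1 - A * (y - α) + B * (y - α) ^ 2 - D * (t - s)))).continuousOn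
    · intro s hs
      have := mul_nonneg hD0.le (sub_nonneg.2 hs.2)
      have := hc s (hdom (hsT s hs))
      simp
      linarith
    · intro s hs
      have := mul_nonneg hD0.le (sub_nonneg.2 hs.2)
      have := hpos (α + ℓ) ⟨by linarith, le_rfl⟩ s (hsT s hs)
      simp
      nlinarith
    · intro y hy
      have h1 := hpos y hy (t₀ / 2) ⟨le_rfl, by linarith⟩
      have h2 := hquad (y - α) ⟨by linarith [hy.1], by linarith [hy.2]⟩
      have h3 : D * (t₀ / 2) ≤ D * (t - t₀ / 2) :=
        mul_le_mul_of_nonneg_left (by linarith [ht.1]) hD0.le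
      linarith
    · intro y hy s hs hneg
      have hyI : ∀ z ∈ Ioo α (α + ℓ), z ∈ Ioo α β := fun z hz => ⟨hz.1, by linarith [hz.2]⟩
      have hsI := hsT s (Ioc_subset_Icc_self hs)
      refine ⟨fun z => p z s - (-A + B * (2 * (z - α))), q y s - B * 2,
        u y s * (q y s + 1 - u y s) - D, ?_, ?_, ?_, ?_⟩
      · filter_upwards [Ioo_mem_nhds hy.1 hy.2] with z hz
        have e1 : HasDerivAt (fun z : ℝ => z - α) 1 z := (hasDerivAt_id z).sub_const α
        refine ((S.hasDerivAt_x z (hyI z hz) s (hdom hsI)).sub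
          ((((e1.const_mul A).const_sub 1).add ((e1.pow 2).const_mul B)).sub_const
            (D * (t - s)))).congr_deriv ?_
        simp
      · have e1 : HasDerivAt (fun z : ℝ => z - α) 1 y := (hasDerivAt_id y).sub_const α
        refine ((S.hasDerivAt_xx y (hyI y hy) s (hdom hsI)).sub
          (((e1.const_mul 2).const_mul B).const_add (-A))).congr_deriv ?_
        simp
      · have e1 : HasDerivAt (fun r : ℝ => t - r) (-1) s := (hasDerivAt_id s).const_sub t
        refine ((S.hasDerivAt_t y (hyI y hy) s
          ⟨(hdom hsI).1, hs.2.trans_lt ht.2⟩).sub ((e1.const_mul D).const_sub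
          (1 - A * (y - α) + B * (y - α) ^ 2))).congr_deriv ?_
        simp
      · by_contra! hcon
        obtain ⟨h1, h2⟩ := hcon
        have h3 := hquad (y - α) ⟨by linarith [hy.1], by linarith [hy.2]⟩
        have h4 := mul_nonneg hD0.le (sub_nonneg.2 hs.2)
        have h5 := hm y (Ioo_subset_Icc_self hy) s hsI
        have h6 : 2 * B ≤ q y s + 1 - u y s := by linarith
        have h7 : m * (2 * B) ≤ u y s * (q y s + 1 - u y s) :=
          mul_le_mul h5 h6 (by positivity) (hm0.le.trans h5)
        linarith
  · have h1 := S.pos x hx t ⟨(h0.trans ht.1).le, ht.2.le⟩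
    have hA0 : 0 < A := by rw [hA]; positivity
    have h2 : A * ℓ ≤ A * (x - α) := mul_le_mul_of_nonneg_left (by linarith) hA0.le
    have h3 : 0 < B * ℓ * ℓ := by positivity
    linarith

theorem exists_x_bound (S : PositiveStrip α β T u p q) {t₀ : ℝ} (ht₀ : t₀ ∈ Ioo 0 T) :
    ∃ M : ℝ, ∀ x ∈ Ioo α β, ∀ t ∈ Ioo t₀ T, |p x t| ≤ M := by
  obtain ⟨A, hA⟩ := S.exists_left_barrier ht₀
  obtain ⟨A', hA'⟩ := S.reflect.exists_left_barrier ht₀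
  refine ⟨max A A' + (1 + 2 / t₀) * (β - α), fun x hx t ht => abs_le.2 ⟨?_, ?_⟩⟩
  · have := S.x_lower_bound ht₀.1 (Ioo_subset_Ioc_self ht) hx (hA t ht x hx)
    linarith [le_max_left A A']
  · have hx' : -x ∈ Ioo (-β) (-α) := ⟨by linarith [hx.2], by linarith [hx.1]⟩
    have := S.reflect.x_lower_bound ht₀.1 (Ioo_subset_Ioc_self ht) hx' (hA' t ht _ hx')
    rw [neg_neg] at this
    linarith [le_max_right A A']

theorem exists_tendsto_x_right (S : PositiveStrip α β T u p q) {t : ℝ} (ht : t ∈ Ioc 0 T)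
    (h0 : u β t = 0) : ∃ L : ℝ, Tendsto (fun x => p x t) (𝓝[<] β) (𝓝 L) := by
  obtain ⟨L, hL⟩ := S.reflect.exists_tendsto_x_left ht (by simpa using h0)
  refine ⟨-L, ?_⟩
  have := (hL.comp (tendsto_neg_nhdsLT (a := β))).neg
  simpa [Function.comp_def] using this

end PositiveStrip

/-- The function `σ u` on `[a, b] × [0, T]`, extended continuously to the plane. -/
noncomputable def signedExtension (a b T σ : ℝ) (u : ℝ → ℝ → ℝ) (x t : ℝ) : ℝ :=
  σ * u (max a (min x b)) (max 0 (min t T))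

theorem signedExtension_eq {a b T σ x t : ℝ} (u : ℝ → ℝ → ℝ) (hx : x ∈ Icc a b)
    (ht : t ∈ Icc 0 T) : signedExtension a b T σ u x t = σ * u x t := by
  rw [signedExtension, min_eq_left hx.2, min_eq_left ht.2, max_eq_right hx.1, max_eq_right ht.1]

namespace IsClassicalSol

variable {a b T : ℝ} {N₀ : Set ℝ} {u₀ : ℝ → ℝ} {u : ℝ → ℝ → ℝ}

theorem signedExtension_eq_zero (hu : IsClassicalSol a b T N₀ u₀ u) (h₀ : InitData a b N₀ u₀)
    {σ x t : ℝ} (hx : x ∈ N₀) (ht : t ∈ Ioc 0 T) : signedExtension a b T σ u x t = 0 := by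
  have hx' := Ioo_subset_Icc_self (h₀.sub hx)
  have ht' := Ioc_subset_Icc_self ht
  rw [signedExtension_eq u hx' ht', (hu.zero_iff x hx' t ht').2 hx, mul_zero]

/-- Between two neighbouring zeros, a solution has constant sign. -/
theorem exists_sign (hu : IsClassicalSol a b T N₀ u₀ u) {α β : ℝ}
    (hsub : Ioo α β ⊆ Icc a b) (hN : ∀ y ∈ Ioo α β, y ∉ N₀) :
    ∃ σ : ℝ, (σ = 1 ∨ σ = -1) ∧ ∀ x ∈ Ioo α β, ∀ t ∈ Icc 0 T, 0 < σ * u x t := by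
  have hne : ∀ z ∈ Ioo α β ×ˢ Icc 0 T, u z.1 z.2 ≠ 0 := fun z hz h =>
    hN z.1 hz.1 ((hu.zero_iff z.1 (hsub hz.1) z.2 hz.2).1 h)
  by_cases hp : ∀ z ∈ Ioo α β ×ˢ Icc 0 T, 0 < u z.1 z.2
  · exact ⟨1, Or.inl rfl, fun x hx t ht => by simpa using hp (x, t) ⟨hx, ht⟩⟩
  · push Not at hp
    obtain ⟨z, hz, hz0⟩ := hp
    refine ⟨-1, Or.inr rfl, fun x hx t ht => ?_⟩
    by_contra! hxt
    obtain ⟨w, hw, hw0⟩ := (isPreconnected_Ioo.prod isPreconnected_Icc).intermediate_value hz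
      (⟨hx, ht⟩ : (x, t) ∈ Ioo α β ×ˢ Icc 0 T)
      (hu.cont.mono (prod_mono hsub le_rfl)) ⟨hz0, by linarith⟩
    exact hne w hw hw0

theorem exists_positiveStrip (hu : IsClassicalSol a b T N₀ u₀ u) (hab : a < b) (hT : 0 < T)
    (h₀ : InitData a b N₀ u₀) {α β : ℝ} (hα : α ∈ insert a (insert b N₀))
    (hβ : β ∈ insert a (insert b N₀)) (hαβ : α < β) (hN : ∀ y ∈ Ioo α β, y ∉ N₀) :
    ∃ σ : ℝ, (σ = 1 ∨ σ = -1) ∧ PositiveStrip α β T (signedExtension a b T σ u)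
      (fun x t => σ * pdx u x t) (fun x t => σ * pdxx u x t) := by
  have hE : ∀ z ∈ insert a (insert b N₀), z ∈ Icc a b := by
    rintro z (rfl | rfl | hz)
    · exact left_mem_Icc.2 hab.le
    · exact right_mem_Icc.2 hab.le
    · exact Ioo_subset_Icc_self (h₀.sub hz)
  have hsub : Ioo α β ⊆ Ioo a b := Ioo_subset_Ioo (hE α hα).1 (hE β hβ).2
  have hsub' : Ioo α β ⊆ Icc a b := hsub.trans Ioo_subset_Icc_self
  obtain ⟨σ, hσ, hpos⟩ := hu.exists_sign hsub' hN
  have hQ : ∀ x ∈ Ioo α β, ∀ t ∈ Ioc 0 T, (x, t) ∈ QT a b T \ NSet N₀ T := fun x hx t ht =>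
    ⟨⟨hsub hx, ht⟩, fun h => hN x hx h.1⟩
  have hQ' : Ioo α β ×ˢ Ioc 0 T ⊆ QT a b T \ NSet N₀ T := fun z hz => hQ z.1 hz.1 z.2 hz.2
  have hcont : Continuous (Function.uncurry (signedExtension a b T σ u)) := by
    refine continuous_const.mul ?_
    refine hu.cont.comp_continuous
      (f := fun z : ℝ × ℝ => (max a (min z.1 b), max 0 (min z.2 T))) (by fun_prop) fun z => ?_
    exact ⟨⟨le_max_left _ _, max_le hab.le (min_le_right _ _)⟩,
      ⟨le_max_left _ _, max_le hT.le (min_le_right _ _)⟩⟩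
  have hposE : ∀ x ∈ Ioo α β, ∀ t ∈ Icc 0 T, 0 < signedExtension a b T σ u x t :=
    fun x hx t ht => by
      rw [signedExtension_eq u (hsub' hx) ht]
      exact hpos x hx t ht
  have hnonneg : ∀ z ∈ Icc α β, ∀ t ∈ Icc 0 T, 0 ≤ σ * u z t := fun z hz t ht => by
    have hcl : IsClosed {x | 0 ≤ signedExtension a b T σ u x t} :=
      isClosed_le continuous_const (hcont.uncurry_right t)
    have := closure_minimal (s := Ioo α β) (fun x hx => (hposE x hx t ht).le) hcl
    rw [closure_Ioo hαβ.ne] at this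
    have hz' : 0 ≤ signedExtension a b T σ u z t := this hz
    rwa [signedExtension_eq u
      ⟨(hE α hα).1.trans hz.1, hz.2.trans (hE β hβ).2⟩ ht] at hz'
  have hend : ∀ z ∈ insert a (insert b N₀), z ∈ Icc α β →
      ∃ c : ℝ, (c = 0 ∨ c = 1) ∧ ∀ t ∈ Ioc 0 T, signedExtension a b T σ u z t = c := by
    intro z hz hzI
    have hTT : T ∈ Ioc 0 T := ⟨hT, le_rfl⟩
    have hzT := hnonneg z hzI T (Ioc_subset_Icc_self hTT)
    have hzE := hE z hz
    rcases hz with rfl | rfl | hz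
    · refine ⟨1, Or.inr rfl, fun t ht => ?_⟩
      rw [signedExtension_eq u hzE (Ioc_subset_Icc_self ht), hu.bdry_a t ht]
      rw [hu.bdry_a T hTT] at hzT
      rcases hσ with rfl | rfl <;> linarith
    · refine ⟨1, Or.inr rfl, fun t ht => ?_⟩
      rw [signedExtension_eq u hzE (Ioc_subset_Icc_self ht), hu.bdry_b t ht]
      rw [hu.bdry_b T hTT] at hzT
      rcases hσ with rfl | rfl <;> linarith
    · exact ⟨0, Or.inl rfl, fun t ht => hu.signedExtension_eq_zero h₀ hz ht⟩
  refine ⟨σ, hσ, hαβ, hcont, hposE, fun x hx t ht => ?_, fun x hx t ht => ?_, fun x hx t ht => ?_,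
    continuousOn_const.mul (hu.cont_x.mono hQ'), continuousOn_const.mul (hu.cont_xx.mono hQ'),
    hend α hα (left_mem_Icc.2 hαβ.le), hend β hβ (right_mem_Icc.2 hαβ.le)⟩
  · refine ((hu.diff_x _ (hQ x hx t ht)).hasDerivAt.const_mul σ).congr_of_eventuallyEq ?_
    filter_upwards [Ioo_mem_nhds hx.1 hx.2] with y hy
    exact signedExtension_eq u (hsub' hy) (Ioc_subset_Icc_self ht)
  · exact (hu.diff_xx _ (hQ x hx t ht)).hasDerivAt.const_mul σ
  · have hxt := hQ x hx t (Ioo_subset_Ioc_self ht)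
    have hd : HasDerivAt (u x) (pdtW T u x t) t :=
      (hu.diff_t _ hxt).hasDerivWithinAt.hasDerivAt (Iic_mem_nhds ht.2)
    have hpde : pdtW T u x t = |u x t| * pdxx u x t + u x t * (1 - |u x t|) := hu.pde _ hxt
    have ht' := Ioo_subset_Icc_self ht
    have habs : |u x t| = σ * u x t := by
      have := hpos x hx t ht'
      rcases hσ with rfl | rfl
      · rw [one_mul] at this ⊢
        exact abs_of_pos this
      · rw [abs_of_neg (by linarith)]
        ring
    rw [signedExtension_eq u (hsub' hx) ht']
    refine ((hd.const_mul σ).congr_of_eventuallyEq ?_).congr_deriv ?_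
    · filter_upwards [Ioo_mem_nhds ht.1 ht.2] with s hs
      exact signedExtension_eq u (hsub' hx) (Ioo_subset_Icc_self hs)
    · rw [hpde, habs]
      ring

end IsClassicalSol

/-- Theorem 3.2(i): `u_x` is bounded on `((a,b) ∖ N₀) × (t₀,T)` for every `t₀ ∈ (0,T)`,
and for every `t ∈ (0,T]` and every `x_i ∈ N₀` the one-sided limits `u_x(x_i^±, t)`
exist and are finite. -/
theorem stmt4 (a b T : ℝ) (hab : a < b) (hT : 0 < T)
    (N₀ : Set ℝ) (u₀ : ℝ → ℝ) (h₀ : InitData a b N₀ u₀)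
    (u : ℝ → ℝ → ℝ) (hu : IsClassicalSol a b T N₀ u₀ u) :
    (∀ t₀ ∈ Set.Ioo (0:ℝ) T, ∃ M : ℝ,
      ∀ x ∈ Set.Ioo a b \ N₀, ∀ t ∈ Set.Ioo t₀ T, |pdx u x t| ≤ M) ∧
    ∀ xi ∈ N₀, ∀ t ∈ Set.Ioc (0:ℝ) T,
      (∃ L : ℝ, Tendsto (fun y => pdx u y t) (𝓝[>] xi) (𝓝 L)) ∧
      (∃ L : ℝ, Tendsto (fun y => pdx u y t) (𝓝[<] xi) (𝓝 L)) := by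
  set E : Set ℝ := insert a (insert b N₀) with hE
  have hEfin : E.Finite := (h₀.fin.insert b).insert a
  have haE : a ∈ E := mem_insert a _
  have hbE : b ∈ E := mem_insert_of_mem a (mem_insert b _)
  have hNE : N₀ ⊆ E := fun z hz => mem_insert_of_mem a (mem_insert_of_mem b hz)
  have hright : ∀ x < b, ∃ β ∈ E, x < β ∧ ∀ z ∈ E, x < z → β ≤ z := fun x hx => by
    obtain ⟨β, hβ, hmin⟩ := exists_min_image (E ∩ Ioi x) id (hEfin.inter_of_left _) ⟨b, hbE, hx⟩
    exact ⟨β, hβ.1, hβ.2, fun z hz hxz => hmin z ⟨hz, hxz⟩⟩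
  have hleft : ∀ x, a < x → ∃ α ∈ E, α < x ∧ ∀ z ∈ E, z < x → z ≤ α := fun x hx => by
    obtain ⟨α, hα, hmax⟩ := exists_max_image (E ∩ Iio x) id (hEfin.inter_of_left _) ⟨a, haE, hx⟩
    exact ⟨α, hα.1, hα.2, fun z hz hzx => hmax z ⟨hz, hzx⟩⟩
  refine ⟨fun t₀ ht₀ => ?_, fun xi hxi t ht => ⟨?_, ?_⟩⟩
  · have hM : ∀ z : ℝ × ℝ, ∃ M : ℝ, z.1 ∈ E → z.2 ∈ E → z.1 < z.2 →
        (∀ y ∈ Ioo z.1 z.2, y ∉ N₀) → ∀ x ∈ Ioo z.1 z.2, ∀ t ∈ Ioo t₀ T, |pdx u x t| ≤ M := by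
      intro z
      by_cases h : z.1 ∈ E ∧ z.2 ∈ E ∧ z.1 < z.2 ∧ ∀ y ∈ Ioo z.1 z.2, y ∉ N₀
      · obtain ⟨h1, h2, h3, h4⟩ := h
        obtain ⟨σ, hσ, S⟩ := hu.exists_positiveStrip hab hT h₀ h1 h2 h3 h4
        obtain ⟨M, hM⟩ := S.exists_x_bound ht₀
        refine ⟨M, fun _ _ _ _ x hx t ht => ?_⟩
        have := hM x hx t ht
        rcases hσ with rfl | rfl <;> simpa using this
      · exact ⟨0, fun h1 h2 h3 h4 => absurd ⟨h1, h2, h3, h4⟩ h⟩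
    choose M hM using hM
    obtain ⟨K, hK⟩ := ((hEfin.prod hEfin).image M).bddAbove
    refine ⟨K, fun x hx t ht => ?_⟩
    obtain ⟨α, hα, hαx, hαmax⟩ := hleft x hx.1.1
    obtain ⟨β, hβ, hxβ, hβmin⟩ := hright x hx.1.2
    refine (hM (α, β) hα hβ (hαx.trans hxβ) (fun y hy hyN => ?_) x ⟨hαx, hxβ⟩ t ht).trans
      (hK ⟨(α, β), ⟨hα, hβ⟩, rfl⟩)
    rcases lt_trichotomy y x with h | rfl | h
    · exact absurd (hαmax y (hNE hyN) h) (not_le.2 hy.1)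
    · exact hx.2 hyN
    · exact absurd (hβmin y (hNE hyN) h) (not_le.2 hy.2)
  · obtain ⟨β, hβ, hxβ, hβmin⟩ := hright xi (h₀.sub hxi).2
    obtain ⟨σ, hσ, S⟩ := hu.exists_positiveStrip hab hT h₀ (hNE hxi) hβ hxβ
      fun y hy hyN => absurd (hβmin y (hNE hyN) hy.1) (not_le.2 hy.2)
    obtain ⟨L, hL⟩ := S.exists_tendsto_x_left ht (hu.signedExtension_eq_zero h₀ hxi ht)
    refine ⟨σ * L, (hL.const_mul σ).congr fun y => ?_⟩
    rcases hσ with rfl | rfl <;> simp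
  · obtain ⟨α, hα, hαx, hαmax⟩ := hleft xi (h₀.sub hxi).1
    obtain ⟨σ, hσ, S⟩ := hu.exists_positiveStrip hab hT h₀ hα (hNE hxi) hαx
      fun y hy hyN => absurd (hαmax y (hNE hyN) hy.2) (not_le.2 hy.1)
    obtain ⟨L, hL⟩ := S.exists_tendsto_x_right ht (hu.signedExtension_eq_zero h₀ hxi ht)
    refine ⟨σ * L, (hL.const_mul σ).congr fun y => ?_⟩
    rcases hσ with rfl | rfl <;> simp
end
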